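/- arXiv:2310.11820 — 7 statements merged into one kernel-verified Lean document; each statement's English description precedes it below -/
import Mathlib

section
/- Let g = g₀ ⊕ g₁ be a quasireductive finite-dimensional Lie superalgebra over F and let x ∈ g₀ be such that [x, a] ∈ Z(g)₀ for all a ∈ g₀ and x • v ∈ Z(g)₁ for all v ∈ g₁. Then x ∈ Z(g)₀, i.e. [x, g₀] = 0 and x • g₁ = 0. (Equivalently, the even part of the center of g/Z(g) vanishes.) -/
/- STATEMENT 0: If g = g₀ ⊕ g₁ is a quasireductive finite-dimensional Lie superalgebra over
an algebraically closed field F of characteristic 0, and x ∈ g₀ maps g₀ into Z(g)₀ and g₁ into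
Z(g)₁ under the adjoint action, then x ∈ Z(g)₀. -/

variable {F : Type} [Field F] [IsAlgClosed F] [CharZero F]
variable {g0 : Type} [LieRing g0] [LieAlgebra F g0] [FiniteDimensional F g0]
variable {g1 : Type} [AddCommGroup g1] [Module F g1] [FiniteDimensional F g1]
variable [LieRingModule g0 g1] [LieModule F g0 g1]

/-- An element that brackets everything into the center lies in the radical. -/
theorem LieAlgebra.mem_radical_of_forall_lie_mem_center {R L : Type*} [CommRing R] [LieRing L]
    [LieAlgebra R L] [IsNoetherian R L] {x : L}
    (hx : ∀ a : L, ⁅a, x⁆ ∈ LieAlgebra.center R L) : x ∈ LieAlgebra.radical R L := by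
  let J : LieIdeal R L := (LieAlgebra.center R L).normalizer
  have hJ : ⁅J, J⁆ ≤ LieAlgebra.center R L := by
    rw [LieSubmodule.lieIdeal_oper_eq_span, LieSubmodule.lieSpan_le]
    rintro _ ⟨⟨a, _⟩, ⟨b, hb⟩, rfl⟩
    exact (LieSubmodule.mem_normalizer _ b).mp hb a
  have hsolv : LieAlgebra.IsSolvable J := by
    refine (LieAlgebra.isSolvable_iff (R := R) (L := J)).mpr ⟨2, ?_⟩
    rw [LieIdeal.derivedSeries_eq_bot_iff, LieAlgebra.derivedSeriesOfIdeal_succ,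
      LieAlgebra.derivedSeriesOfIdeal_succ, LieAlgebra.derivedSeriesOfIdeal_zero,
      LieSubmodule.lie_eq_bot_iff]
    intro a _ b hb
    exact hJ hb a
  exact (LieIdeal.solvable_iff_le_radical R L J).mp hsolv ((LieSubmodule.mem_normalizer _ x).mpr hx)

theorem stmt0
    (br : g1 →ₗ[F] g1 →ₗ[F] g0)
    (hsymm : ∀ v w : g1, br v w = br w v)
    (hequiv : ∀ (a : g0) (v w : g1), ⁅a, br v w⁆ = br ⁅a, v⁆ w + br v ⁅a, w⁆)
    (hjac : ∀ u v w : g1, ⁅br u v, w⁆ + ⁅br v w, u⁆ + ⁅br w u, v⁆ = 0)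
    (hred : LieAlgebra.radical F g0 = LieAlgebra.center F g0)
    (hss : ∀ N : LieSubmodule F g0 g1, ∃ N', IsCompl N N')
    (x : g0)
    (hx0 : ∀ a : g0, (∀ b : g0, ⁅⁅x, a⁆, b⁆ = 0) ∧ (∀ v : g1, ⁅⁅x, a⁆, v⁆ = 0))
    (hx1 : ∀ v : g1, (∀ a : g0, ⁅a, ⁅x, v⁆⁆ = 0) ∧ (∀ w : g1, br ⁅x, v⁆ w = 0)) :
    (∀ a : g0, ⁅x, a⁆ = 0) ∧ (∀ v : g1, ⁅x, v⁆ = 0) := by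
  have hcomm : ∀ a : g0, ⁅a, x⁆ = 0 := by
    have hx : x ∈ LieAlgebra.radical F g0 := by
      refine LieAlgebra.mem_radical_of_forall_lie_mem_center fun a b => ?_
      rw [← lie_skew a x, lie_neg, ← lie_skew, (hx0 a).1 b, neg_zero, neg_zero]
    rw [hred] at hx
    exact hx
  refine ⟨fun a => by rw [← lie_skew, hcomm, neg_zero], fun v => ?_⟩
  obtain ⟨N', hN'⟩ := hss (LieModule.maxTrivSubmodule F g0 g1)
  have hv : v ∈ LieModule.maxTrivSubmodule F g0 g1 ⊔ N' := hN'.sup_eq_top ▸ LieSubmodule.mem_top v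
  obtain ⟨t, ht, n, hn, rfl⟩ := (LieSubmodule.mem_sup _ _ _).mp hv
  have hxn : ⁅x, n⁆ ∈ LieModule.maxTrivSubmodule F g0 g1 ⊓ N' :=
    (LieSubmodule.mem_inf _ _ _).mpr ⟨(hx1 n).1, N'.lie_mem hn⟩
  rw [hN'.inf_eq_bot, LieSubmodule.mem_bot] at hxn
  rw [lie_add, hxn, ht x, add_zero]
end

section
/- Let g be a quasireductive finite-dimensional Lie superalgebra over F with Z(g)₀ = 0, and let l = (l₀, l₁) be a minimal ideal of g. Then at least one of the following holds: (1) l is a simple Lie superalgebra, i.e. its bracket is not identically zero ([l₀,l₀], l₀ • l₁ and ⟨l₁,l₁⟩ are not all zero) and the only ideals of the Lie superalgebra (l₀, l₁) with the restricted operations are 0 and l itself; (2) l₀ = 0 (so l = l₁ is odd and abelian, since ⟨l₁,l₁⟩ ⊆ l₀ = 0); (3) l₀ is a simple Lie algebra, ⟨l₁, l₁⟩ = 0, and l₁ is isomorphic as an l₀-module to the adjoint module l₀ (i.e. l ≅ k^d for the simple Lie algebra k = l₀). -/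
/- STATEMENT 1: trichotomy for a minimal ideal l of a quasireductive finite-dimensional
Lie superalgebra g with Z(g)₀ = 0: l is simple, or l is odd abelian, or l ≅ k^d. -/

variable {F : Type} [Field F] [IsAlgClosed F] [CharZero F]
variable {g0 : Type} [LieRing g0] [LieAlgebra F g0] [FiniteDimensional F g0]
variable {g1 : Type} [AddCommGroup g1] [Module F g1] [FiniteDimensional F g1]
variable [LieRingModule g0 g1] [LieModule F g0 g1]

/-- An ideal of the Lie superalgebra `(g0, g1, br)`. -/
def IsIdeal (br : g1 →ₗ[F] g1 →ₗ[F] g0)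
    (l0 : Submodule F g0) (l1 : Submodule F g1) : Prop :=
  (∀ a : g0, ∀ x ∈ l0, ⁅a, x⁆ ∈ l0) ∧
  (∀ a : g0, ∀ v ∈ l1, ⁅a, v⁆ ∈ l1) ∧
  (∀ x ∈ l0, ∀ v : g1, ⁅x, v⁆ ∈ l1) ∧
  (∀ v ∈ l1, ∀ w : g1, br v w ∈ l0)

/-- A minimal (nonzero) ideal of the Lie superalgebra `(g0, g1, br)`. -/
def IsMinimalIdeal (br : g1 →ₗ[F] g1 →ₗ[F] g0)
    (l0 : Submodule F g0) (l1 : Submodule F g1) : Prop :=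
  IsIdeal br l0 l1 ∧ (l0 ≠ ⊥ ∨ l1 ≠ ⊥) ∧
  ∀ m0 : Submodule F g0, ∀ m1 : Submodule F g1,
    IsIdeal br m0 m1 → m0 ≤ l0 → m1 ≤ l1 → (m0 ≠ ⊥ ∨ m1 ≠ ⊥) → m0 = l0 ∧ m1 = l1

set_option linter.unusedSectionVars false

/-- In a semisimple module, an element that is central and a commutator acts by zero: it has trace
zero on each of its eigenspaces. -/
theorem lie_eq_zero_of_central_commutator {K L M : Type*} [Field K] [IsAlgClosed K] [CharZero K]
    [LieRing L] [LieAlgebra K L] [AddCommGroup M] [Module K M] [FiniteDimensional K M]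
    [LieRingModule L M] [LieModule K L M]
    (hss : ∀ N : LieSubmodule K L M, ∃ N', IsCompl N N')
    (c x : L) (hz : ∀ a : L, ⁅a, ⁅c, x⁆⁆ = 0) (v : M) : ⁅⁅c, x⁆, v⁆ = 0 := by
  set z := ⁅c, x⁆
  have hcomm (a : L) (w : M) : ⁅z, ⁅a, w⁆⁆ = ⁅a, ⁅z, w⁆⁆ := by
    rw [leibniz_lie a z w, hz a, zero_lie, zero_add]
  let E (μ : K) : LieSubmodule K L M :=
    { Module.End.eigenspace (LieModule.toEnd K L M z) μ with
      lie_mem := by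
        intro a m hm
        have hm' : ⁅z, m⁆ = μ • m := Module.End.mem_eigenspace_iff.mp hm
        refine Module.End.mem_eigenspace_iff.mpr ?_
        rw [LieModule.toEnd_apply_apply, hcomm, hm', lie_smul] }
  have hE (μ : K) (m : M) : m ∈ E μ ↔ ⁅z, m⁆ = μ • m := Module.End.mem_eigenspace_iff
  have hEbot (μ : K) (hμ : μ ≠ 0) : E μ = ⊥ := by
    have htr : LinearMap.trace K _ (LieModule.toEnd K L (E μ) z) = 0 := by
      refine LieModule.trace_toEnd_eq_zero_of_mem_lcs K L (E μ) le_rfl ?_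
      rw [LieModule.lowerCentralSeries_succ]
      exact LieSubmodule.lie_mem_lie (LieSubmodule.mem_top c) (LieSubmodule.mem_top x)
    have hsc : LieModule.toEnd K L (E μ) z = μ • LinearMap.id := by
      ext m
      exact (hE μ m).mp m.2
    rw [hsc, map_smul, LinearMap.trace_id, smul_eq_mul, mul_eq_zero, Nat.cast_eq_zero] at htr
    have h0 := htr.resolve_left hμ
    rw [← LieSubmodule.toSubmodule_eq_bot]
    exact Submodule.finrank_eq_zero.mp h0
  obtain ⟨N, hN⟩ := hss (E 0)
  have hNbot : N = ⊥ := by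
    by_contra hne
    have : Nontrivial N := (LieSubmodule.nontrivial_iff_ne_bot K L M).mpr hne
    obtain ⟨μ, hμ⟩ := Module.End.exists_eigenvalue (LieModule.toEnd K L N z)
    obtain ⟨w, hw⟩ := hμ.exists_hasEigenvector
    have hw1 : ⁅z, (w : M)⁆ = μ • (w : M) :=
      congrArg Subtype.val (Module.End.mem_eigenspace_iff.mp hw.1)
    have hw0 : (w : M) ≠ 0 := fun h => hw.2 (Subtype.ext h)
    by_cases h : μ = 0
    · subst h
      have : (w : M) ∈ E 0 ⊓ N := ⟨(hE 0 _).mpr hw1, w.2⟩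
      rw [hN.inf_eq_bot] at this
      exact hw0 ((LieSubmodule.mem_bot _).mp this)
    · have : (w : M) ∈ E μ := (hE μ _).mpr hw1
      rw [hEbot μ h] at this
      exact hw0 ((LieSubmodule.mem_bot _).mp this)
  have htop := hN.sup_eq_top
  rw [hNbot, sup_bot_eq] at htop
  have hv : v ∈ E 0 := htop ▸ LieSubmodule.mem_top v
  simpa using (hE 0 v).mp hv

/-- In a Lie algebra whose radical is central, an ideal and its Killing complement span. -/
theorem sup_killingCompl_eq_top {K L : Type*} [Field K] [CharZero K] [LieRing L] [LieAlgebra K L]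
    [FiniteDimensional K L]
    (hred : LieAlgebra.radical K L = LieAlgebra.center K L) (J : LieIdeal K L) :
    (∀ x ∈ J, x ∈ J.killingCompl → x ∈ LieAlgebra.center K L) ∧
      J.toSubmodule ⊔ J.killingCompl.toSubmodule = ⊤ := by
  have h1 : J ⊓ J.killingCompl ≤ LieAlgebra.center K L := by
    rw [← hred, ← LieAlgebra.LieIdeal.solvable_iff_le_radical]
    refine LieIdeal.isSolvable_of_killingForm_apply_lie_eq_zero _ fun x hx y hy => ?_
    have hy' : y ∈ J ⊓ J.killingCompl := LieSubmodule.lie_le_left _ _ hy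
    exact (LieIdeal.mem_killingCompl K L J).mp hy'.2 x hx.1
  refine ⟨fun x hx hx' => h1 ⟨hx, hx'⟩, ?_⟩
  have hle : J.toSubmodule ⊓ (killingForm K L).orthogonal J.toSubmodule ≤
      J.toSubmodule ⊓ LinearMap.ker (killingForm K L) := by
    rintro x ⟨hx, hx'⟩
    refine ⟨hx, ?_⟩
    have hc : ∀ a : L, ⁅a, x⁆ = 0 := h1 (show x ∈ J ⊓ J.killingCompl from ⟨hx, hx'⟩)
    have had : LieAlgebra.ad K L x = 0 := by
      ext a
      simp [← lie_skew x a, hc a]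
    refine LinearMap.mem_ker.mpr ?_
    ext a
    simp [killingForm_apply_apply, had]
  apply Submodule.eq_top_of_finrank_eq
  apply le_antisymm (Submodule.finrank_le _)
  have e1 := LinearMap.BilinForm.finrank_add_finrank_orthogonal' (B := killingForm K L)
    J.toSubmodule
  have e2 := Submodule.finrank_sup_add_finrank_inf_eq J.toSubmodule
    ((killingForm K L).orthogonal J.toSubmodule)
  have e3 := Submodule.finrank_mono hle
  rw [LieIdeal.toSubmodule_killingCompl]
  omega

/-- In the even part of a quasireductive Lie superalgebra with trivial even center, being an ideal
is a transitive relation. -/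
theorem lie_mem_of_ideal_of_ideal
    (hred : LieAlgebra.radical F g0 = LieAlgebra.center F g0)
    (hss : ∀ N : LieSubmodule F g0 g1, ∃ N', IsCompl N N')
    (hZ0 : ∀ x : g0, (∀ a : g0, ⁅x, a⁆ = 0) → (∀ v : g1, ⁅x, v⁆ = 0) → x = 0)
    (l0 : Submodule F g0) (hl0 : ∀ a : g0, ∀ x ∈ l0, ⁅a, x⁆ ∈ l0)
    (i0 : Submodule F g0) (hi : i0 ≤ l0) (hi0 : ∀ a ∈ l0, ∀ x ∈ i0, ⁅a, x⁆ ∈ i0)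
    (a x : g0) (hx : x ∈ i0) : ⁅a, x⁆ ∈ i0 := by
  let J : LieIdeal F g0 := { l0 with lie_mem := fun {a x} hx => hl0 a x hx }
  obtain ⟨hJ, htop⟩ := sup_killingCompl_eq_top hred J
  obtain ⟨j, hj, c, hc, rfl⟩ := Submodule.mem_sup.mp (htop ▸ Submodule.mem_top : a ∈ _)
  have hcent : ⁅c, x⁆ ∈ LieAlgebra.center F g0 :=
    hJ _ (hl0 c x (hi hx)) (lie_mem_left F g0 _ c x hc)
  have hzero : ⁅c, x⁆ = 0 :=
    hZ0 _ (fun b => by rw [← lie_skew, hcent b, neg_zero])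
      (lie_eq_zero_of_central_commutator hss c x hcent)
  rw [add_lie, hzero, add_zero]
  exact hi0 j hj x hx

/-- The odd part of an ideal has an invariant complement, which the even part annihilates. -/
theorem IsIdeal.exists_annihilated_complement {br : g1 →ₗ[F] g1 →ₗ[F] g0}
    (hss : ∀ N : LieSubmodule F g0 g1, ∃ N', IsCompl N N')
    {l0 : Submodule F g0} {l1 : Submodule F g1} (hl : IsIdeal br l0 l1) :
    ∃ N : LieSubmodule F g0 g1, (∀ x ∈ l0, ∀ n ∈ N, ⁅x, n⁆ = 0) ∧
      ∀ w : g1, ∃ u ∈ l1, ∃ n ∈ N, u + n = w := by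
  let L1 : LieSubmodule F g0 g1 := { l1 with lie_mem := fun {a v} hv => hl.2.1 a v hv }
  obtain ⟨N, hN⟩ := hss L1
  refine ⟨N, fun x hx n hn => ?_, fun w => ?_⟩
  · have h : ⁅x, n⁆ ∈ L1 ⊓ N := ⟨hl.2.2.1 x hx n, N.lie_mem hn⟩
    rw [hN.inf_eq_bot] at h
    exact (LieSubmodule.mem_bot _).mp h
  · have h : w ∈ L1 ⊔ N := hN.sup_eq_top ▸ LieSubmodule.mem_top w
    exact (LieSubmodule.mem_sup _ _ _).mp h

/-- The even part of an ideal is zero if it is abelian and acts trivially on the odd part. -/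
theorem IsIdeal.even_eq_bot_of_trivial {br : g1 →ₗ[F] g1 →ₗ[F] g0}
    (hred : LieAlgebra.radical F g0 = LieAlgebra.center F g0)
    (hss : ∀ N : LieSubmodule F g0 g1, ∃ N', IsCompl N N')
    (hZ0 : ∀ x : g0, (∀ a : g0, ⁅x, a⁆ = 0) → (∀ v : g1, ⁅x, v⁆ = 0) → x = 0)
    {l0 : Submodule F g0} {l1 : Submodule F g1} (hl : IsIdeal br l0 l1)
    (hab : ∀ a ∈ l0, ∀ b ∈ l0, ⁅a, b⁆ = 0) (htriv : ∀ a ∈ l0, ∀ v ∈ l1, ⁅a, v⁆ = 0) :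
    l0 = ⊥ := by
  let J : LieIdeal F g0 := { l0 with lie_mem := fun {a x} hx => hl.1 a x hx }
  have hJab : IsLieAbelian J := ⟨fun x y => Subtype.ext (hab x x.2 y y.2)⟩
  have hJ : J ≤ LieAlgebra.center F g0 := by
    rw [← hred, ← LieAlgebra.LieIdeal.solvable_iff_le_radical]
    infer_instance
  obtain ⟨N, hN, hsum⟩ := hl.exists_annihilated_complement hss
  refine (Submodule.eq_bot_iff _).mpr fun x hx => hZ0 x (fun a => ?_) fun w => ?_
  · have hc : ∀ b : g0, ⁅b, x⁆ = 0 := hJ (show x ∈ J from hx)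
    rw [← lie_skew, hc a, neg_zero]
  · obtain ⟨u, hu, n, hn, rfl⟩ := hsum w
    rw [lie_add, htriv x hx u hu, hN x hx n hn, add_zero]

/-- The span of the brackets of a set of even elements with a set of odd elements. -/
def oddBracketSpan (I : Submodule F g0) (l1 : Submodule F g1) : Submodule F g1 :=
  Submodule.span F {m | ∃ x ∈ I, ∃ v ∈ l1, ⁅x, v⁆ = m}

theorem lie_mem_oddBracketSpan {I : Submodule F g0} {l1 : Submodule F g1} {x : g0} (hx : x ∈ I)
    {v : g1} (hv : v ∈ l1) : ⁅x, v⁆ ∈ oddBracketSpan I l1 :=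
  Submodule.subset_span ⟨x, hx, v, hv, rfl⟩

theorem oddBracketSpan_le {I : Submodule F g0} {l1 m1 : Submodule F g1}
    (h : ∀ x ∈ I, ∀ v ∈ l1, ⁅x, v⁆ ∈ m1) : oddBracketSpan I l1 ≤ m1 := by
  refine Submodule.span_le.mpr ?_
  rintro _ ⟨x, hx, v, hv, rfl⟩
  exact h x hx v hv

/-- An ideal `I` of `g0` inside the even part of a minimal ideal, compatible with the odd bracket,
is the whole even part, and the odd part is spanned by its brackets with `I`. -/
theorem IsMinimalIdeal.eq_of_even_ideal {br : g1 →ₗ[F] g1 →ₗ[F] g0}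
    (hequiv : ∀ (a : g0) (v w : g1), ⁅a, br v w⁆ = br ⁅a, v⁆ w + br v ⁅a, w⁆)
    (hss : ∀ N : LieSubmodule F g0 g1, ∃ N', IsCompl N N')
    {l0 : Submodule F g0} {l1 : Submodule F g1} (hmin : IsMinimalIdeal br l0 l1)
    {I : Submodule F g0} (hI : ∀ a : g0, ∀ x ∈ I, ⁅a, x⁆ ∈ I) (hle : I ≤ l0) (hne : I ≠ ⊥)
    (hpair : ∀ x ∈ I, ∀ v ∈ l1, ∀ w ∈ l1, br v ⁅x, w⁆ ∈ I) :
    I = l0 ∧ oddBracketSpan I l1 = l1 := by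
  obtain ⟨hl, -, hminl⟩ := hmin
  obtain ⟨N, hN, hsum⟩ := hl.exists_annihilated_complement hss
  refine hminl I (oddBracketSpan I l1) ⟨hI, fun a m hm => ?_, fun x hx w => ?_, fun m hm w => ?_⟩
    hle (oddBracketSpan_le fun x _ v hv => hl.2.1 x v hv) (Or.inl hne)
  · refine oddBracketSpan_le (m1 := (oddBracketSpan I l1).comap (LieModule.toEnd F g0 g1 a))
      (fun x hx v hv => ?_) hm
    rw [Submodule.mem_comap, LieModule.toEnd_apply_apply, leibniz_lie]
    exact add_mem (lie_mem_oddBracketSpan (hI a x hx) hv)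
      (lie_mem_oddBracketSpan hx (hl.2.1 a v hv))
  · obtain ⟨u, hu, n, hn, rfl⟩ := hsum w
    rw [lie_add, hN x (hle hx) n hn, add_zero]
    exact lie_mem_oddBracketSpan hx hu
  · refine oddBracketSpan_le (m1 := I.comap (br.flip w)) (fun x hx v hv => ?_) hm
    obtain ⟨u, hu, n, hn, rfl⟩ := hsum w
    have h := hequiv x v (u + n)
    rw [lie_add, hN x (hle hx) n hn, add_zero] at h
    rw [Submodule.mem_comap, LinearMap.flip_apply, eq_sub_of_add_eq h.symm]
    refine sub_mem ?_ (hpair x hx v hv u hu)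
    rw [← lie_skew]
    exact neg_mem (hI _ x hx)

/-- If the even part of a minimal ideal is nonzero, no nonzero odd element of it pairs trivially
with the whole superalgebra. -/
theorem IsMinimalIdeal.eq_zero_of_pairing_eq_zero {br : g1 →ₗ[F] g1 →ₗ[F] g0}
    (hequiv : ∀ (a : g0) (v w : g1), ⁅a, br v w⁆ = br ⁅a, v⁆ w + br v ⁅a, w⁆)
    {l0 : Submodule F g0} {l1 : Submodule F g1} (hmin : IsMinimalIdeal br l0 l1) (h0 : l0 ≠ ⊥)
    {v : g1} (hv : v ∈ l1) (hvw : ∀ w, br v w = 0) : v = 0 := by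
  obtain ⟨hl, -, hminl⟩ := hmin
  by_contra hne
  have hker (a : g0) (u : g1) (hu : br u = 0) : br ⁅a, u⁆ = 0 := by
    ext w
    have h := hequiv a u w
    rw [hu] at h
    simpa using h.symm
  refine h0 (hminl ⊥ (l1 ⊓ LinearMap.ker br) ⟨?_, ?_, ?_, ?_⟩ bot_le inf_le_left
    (Or.inr ?_)).1.symm
  · rintro a x hx
    rw [(Submodule.mem_bot F).mp hx, lie_zero]
    exact zero_mem _
  · exact fun a u hu => ⟨hl.2.1 a u hu.1, hker a u hu.2⟩
  · rintro x hx u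
    rw [(Submodule.mem_bot F).mp hx, zero_lie]
    exact zero_mem _
  · intro u hu w
    rw [LinearMap.mem_ker.mp hu.2]
    exact zero_mem _
  · exact fun hbot => hne ((Submodule.eq_bot_iff _).mp hbot v ⟨hv, LinearMap.ext hvw⟩)

/-- If the odd bracket of a minimal ideal is degenerate and its even part is nonzero, then the odd
bracket of the ideal vanishes. -/
theorem IsMinimalIdeal.pairing_eq_zero_of_degenerate {br : g1 →ₗ[F] g1 →ₗ[F] g0}
    (hsymm : ∀ v w : g1, br v w = br w v)
    (hequiv : ∀ (a : g0) (v w : g1), ⁅a, br v w⁆ = br ⁅a, v⁆ w + br v ⁅a, w⁆)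
    (hjac : ∀ u v w : g1, ⁅br u v, w⁆ + ⁅br v w, u⁆ + ⁅br w u, v⁆ = 0)
    (hss : ∀ N : LieSubmodule F g0 g1, ∃ N', IsCompl N N')
    {l0 : Submodule F g0} {l1 : Submodule F g1} (hmin : IsMinimalIdeal br l0 l1)
    {k : g1} (hk : k ∈ l1) (hk0 : k ≠ 0) (hkl : ∀ w ∈ l1, br k w = 0) :
    ∀ v ∈ l1, ∀ w ∈ l1, br v w = 0 := by
  obtain ⟨hl, -, hminl⟩ := hmin
  obtain ⟨N, hN, hsum⟩ := hl.exists_annihilated_complement hss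
  let K : Submodule F g1 :=
    { carrier := {v | v ∈ l1 ∧ ∀ w ∈ l1, br v w = 0}
      zero_mem' := ⟨zero_mem _, fun w _ => by simp⟩
      add_mem' := fun ha hb => ⟨add_mem ha.1 hb.1, fun w hw => by simp [ha.2 w hw, hb.2 w hw]⟩
      smul_mem' := fun c v hv => ⟨Submodule.smul_mem _ c hv.1, fun w hw => by simp [hv.2 w hw]⟩ }
  have hKlie (a : g0) (v : g1) (hv : v ∈ K) : ⁅a, v⁆ ∈ K := by
    refine ⟨hl.2.1 a v hv.1, fun w hw => ?_⟩
    have h := hequiv a v w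
    rw [hv.2 w hw, lie_zero, hv.2 _ (hl.2.1 a w hw), add_zero] at h
    exact h.symm
  let m0 : Submodule F g0 := Submodule.span F {x | ∃ v ∈ K, ∃ w, br v w = x}
  have hm0 (v : g1) (hv : v ∈ K) (w : g1) : br v w ∈ m0 := Submodule.subset_span ⟨v, hv, w, rfl⟩
  have hm0_le (p : Submodule F g0) (h : ∀ v ∈ K, ∀ w, br v w ∈ p) : m0 ≤ p := by
    refine Submodule.span_le.mpr ?_
    rintro _ ⟨v, hv, w, rfl⟩
    exact h v hv w
  have hideal : IsIdeal br m0 K := by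
    refine ⟨fun a x hx => ?_, hKlie, fun x hx w => ?_, hm0⟩
    · refine hm0_le (m0.comap (LieAlgebra.ad F g0 a : g0 →ₗ[F] g0)) (fun v hv w => ?_) hx
      rw [Submodule.mem_comap, LieAlgebra.ad_apply, hequiv]
      exact add_mem (hm0 _ (hKlie a v hv) w) (hm0 v hv _)
    · refine hm0_le (K.comap ((LieModule.toEnd F g0 g1 : g0 →ₗ[F] Module.End F g1).flip w))
        (fun v hv u => ?_) hx
      change ⁅br v u, w⁆ ∈ K
      obtain ⟨w', hw', n, hn, rfl⟩ := hsum w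
      have h := hjac v u w'
      rw [hsymm w' v, hv.2 w' hw', zero_lie, add_zero] at h
      rw [lie_add, hN _ (hl.2.2.2 v hv.1 u) n hn, add_zero, eq_neg_of_add_eq_zero_left h]
      exact neg_mem (hKlie _ v hv)
  have hKl := (hminl m0 K hideal (hm0_le l0 fun v hv w => hl.2.2.2 v hv.1 w) (fun v hv => hv.1)
    (Or.inr fun hbot => hk0 ((Submodule.eq_bot_iff _).mp hbot k ⟨hk, hkl⟩))).2
  exact fun v hv w hw => (hKl ▸ hv : v ∈ K).2 w hw

/-- If the odd bracket of a minimal ideal vanishes while both parts are nonzero, and its even part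
is a simple Lie algebra, then the odd part is isomorphic to the adjoint module of the even part. -/
theorem IsMinimalIdeal.exists_equiv_adjoint {br : g1 →ₗ[F] g1 →ₗ[F] g0}
    (hsymm : ∀ v w : g1, br v w = br w v)
    (hequiv : ∀ (a : g0) (v w : g1), ⁅a, br v w⁆ = br ⁅a, v⁆ w + br v ⁅a, w⁆)
    (hjac : ∀ u v w : g1, ⁅br u v, w⁆ + ⁅br v w, u⁆ + ⁅br w u, v⁆ = 0)
    (hss : ∀ N : LieSubmodule F g0 g1, ∃ N', IsCompl N N')
    {l0 : Submodule F g0} {l1 : Submodule F g1} (hmin : IsMinimalIdeal br l0 l1)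
    (h0 : l0 ≠ ⊥) (h1 : l1 ≠ ⊥) (hzero : ∀ v ∈ l1, ∀ w ∈ l1, br v w = 0)
    (hnab : ¬ (∀ a ∈ l0, ∀ b ∈ l0, ⁅a, b⁆ = (0 : g0)))
    (hsimple : ∀ i0 : Submodule F g0, i0 ≤ l0 → (∀ a ∈ l0, ∀ x ∈ i0, ⁅a, x⁆ ∈ i0) →
      i0 = ⊥ ∨ i0 = l0) :
    ∃ e : l1 ≃ₗ[F] l0, ∀ (a : l0) (v : l1) (h : ⁅(a : g0), (v : g1)⁆ ∈ l1),
      ((e ⟨⁅(a : g0), (v : g1)⁆, h⟩ : l0) : g0) = ⁅(a : g0), ((e v : l0) : g0)⁆ := by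
  have hl := hmin.1
  obtain ⟨N, hN, hsum⟩ := hl.exists_annihilated_complement hss
  obtain ⟨n, hn, v₀, hv₀, hnv₀⟩ : ∃ n ∈ N, ∃ v ∈ l1, br v n ≠ 0 := by
    by_contra! hcon
    refine h1 ((Submodule.eq_bot_iff _).mpr fun v hv =>
      hmin.eq_zero_of_pairing_eq_zero hequiv h0 hv fun w => ?_)
    obtain ⟨u, hu, n, hn, rfl⟩ := hsum w
    rw [map_add, hzero v hv u hu, hcon n hn v hv, add_zero]
  have hD (a : g0) (ha : a ∈ l0) (v : g1) : br ⁅a, v⁆ n = ⁅a, br v n⁆ := by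
    rw [hequiv, hN a ha n hn, map_zero, add_zero]
  have hcenter (x : g0) (hx : x ∈ l0) (hxc : ∀ a ∈ l0, ⁅a, x⁆ = 0) : x = 0 := by
    let C : Submodule F g0 :=
      { carrier := {y | y ∈ l0 ∧ ∀ a ∈ l0, ⁅a, y⁆ = 0}
        zero_mem' := ⟨zero_mem _, fun a _ => lie_zero a⟩
        add_mem' := fun hy hz =>
          ⟨add_mem hy.1 hz.1, fun a ha => by rw [lie_add, hy.2 a ha, hz.2 a ha, add_zero]⟩
        smul_mem' := fun c y hy =>
          ⟨Submodule.smul_mem _ c hy.1, fun a ha => by rw [lie_smul, hy.2 a ha, smul_zero]⟩ }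
    rcases hsimple C (fun y hy => hy.1) (fun a ha y hy => hy.2 a ha ▸ zero_mem C) with hC | hC
    · exact (Submodule.eq_bot_iff _).mp hC x ⟨hx, hxc⟩
    · exact absurd (fun a ha b hb => (hC ▸ hb : b ∈ C).2 a ha) hnab
  have hrange : l1.map (br.flip n) = l0 := by
    refine (hsimple _ ?_ ?_).resolve_left fun hbot => hnv₀ ?_
    · rintro _ ⟨v, hv, rfl⟩
      exact hl.2.2.2 v hv n
    · rintro a ha _ ⟨v, hv, rfl⟩
      exact ⟨⁅a, v⁆, hl.2.1 a v hv, hD a ha v⟩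
    · exact (Submodule.eq_bot_iff _).mp hbot _ (Submodule.mem_map_of_mem hv₀)
  have hinj (v : g1) (hv : v ∈ l1) (hvn : br v n = 0) : v = 0 := by
    have hann (x : g0) (hx : x ∈ l0) : ⁅x, v⁆ = 0 := by
      obtain ⟨w, hw, rfl⟩ := hrange ▸ hx
      have h := hjac v n w
      rw [hvn, zero_lie, zero_add, hzero w hw v hv, zero_lie, add_zero, hsymm] at h
      exact h
    refine hmin.eq_zero_of_pairing_eq_zero hequiv h0 hv fun w =>
      hcenter _ (hl.2.2.2 v hv w) fun x hx => ?_
    rw [hequiv, hann x hx, hzero v hv _ (hl.2.2.1 x hx w), map_zero, LinearMap.zero_apply, add_zero]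
  let f : l1 →ₗ[F] l0 := (br.flip n).restrict fun v hv => hl.2.2.2 v hv n
  refine ⟨LinearEquiv.ofBijective f ⟨?_, ?_⟩, fun a v _ => hD a a.2 v⟩
  · refine (injective_iff_map_eq_zero f).mpr fun v hv => ?_
    exact Subtype.ext (hinj v v.2 (congrArg Subtype.val hv))
  · rintro ⟨x, hx⟩
    obtain ⟨v, hv, hvx⟩ := hrange.symm ▸ hx
    exact ⟨⟨v, hv⟩, Subtype.ext hvx⟩

theorem stmt1
    (br : g1 →ₗ[F] g1 →ₗ[F] g0)
    (hsymm : ∀ v w : g1, br v w = br w v)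
    (hequiv : ∀ (a : g0) (v w : g1), ⁅a, br v w⁆ = br ⁅a, v⁆ w + br v ⁅a, w⁆)
    (hjac : ∀ u v w : g1, ⁅br u v, w⁆ + ⁅br v w, u⁆ + ⁅br w u, v⁆ = 0)
    (hred : LieAlgebra.radical F g0 = LieAlgebra.center F g0)
    (hss : ∀ N : LieSubmodule F g0 g1, ∃ N', IsCompl N N')
    (hZ0 : ∀ x : g0, (∀ a : g0, ⁅x, a⁆ = 0) → (∀ v : g1, ⁅x, v⁆ = 0) → x = 0)
    (l0 : Submodule F g0) (l1 : Submodule F g1)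
    (hmin : IsMinimalIdeal br l0 l1) :
    -- (1) l is a simple Lie superalgebra
    ((¬ ((∀ a ∈ l0, ∀ b ∈ l0, ⁅a, b⁆ = (0 : g0)) ∧
         (∀ a ∈ l0, ∀ v ∈ l1, ⁅a, v⁆ = (0 : g1)) ∧
         (∀ v ∈ l1, ∀ w ∈ l1, br v w = 0))) ∧
      (∀ i0 : Submodule F g0, ∀ i1 : Submodule F g1, i0 ≤ l0 → i1 ≤ l1 →
        (∀ a ∈ l0, ∀ x ∈ i0, ⁅a, x⁆ ∈ i0) →
        (∀ a ∈ l0, ∀ v ∈ i1, ⁅a, v⁆ ∈ i1) →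
        (∀ x ∈ i0, ∀ v ∈ l1, ⁅x, v⁆ ∈ i1) →
        (∀ v ∈ i1, ∀ w ∈ l1, br v w ∈ i0) →
        (i0 = ⊥ ∧ i1 = ⊥) ∨ (i0 = l0 ∧ i1 = l1))) ∨
    -- (2) l is odd (and hence abelian)
    (l0 = ⊥) ∨
    -- (3) l ≅ k^d for the simple Lie algebra k = l₀
    ((l0 ≠ ⊥ ∧
      (¬ (∀ a ∈ l0, ∀ b ∈ l0, ⁅a, b⁆ = (0 : g0))) ∧
      (∀ i0 : Submodule F g0, i0 ≤ l0 → (∀ a ∈ l0, ∀ x ∈ i0, ⁅a, x⁆ ∈ i0) →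
        i0 = ⊥ ∨ i0 = l0)) ∧
     (∀ v ∈ l1, ∀ w ∈ l1, br v w = 0) ∧
     (∃ e : l1 ≃ₗ[F] l0, ∀ (a : l0) (v : l1) (h : ⁅(a : g0), (v : g1)⁆ ∈ l1),
        ((e ⟨⁅(a : g0), (v : g1)⁆, h⟩ : l0) : g0) = ⁅(a : g0), ((e v : l0) : g0)⁆)) := by
  have hl := hmin.1
  by_cases h0 : l0 = ⊥
  · exact Or.inr (Or.inl h0)
  have htrans := lie_mem_of_ideal_of_ideal hred hss hZ0 l0 hl.1
  by_cases hK : ∃ k ∈ l1, k ≠ 0 ∧ ∀ w ∈ l1, br k w = 0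
  · obtain ⟨k, hk, hk0, hkl⟩ := hK
    have h1 : l1 ≠ ⊥ := fun h => hk0 ((Submodule.eq_bot_iff _).mp h k hk)
    have hzero := hmin.pairing_eq_zero_of_degenerate hsymm hequiv hjac hss hk hk0 hkl
    have hnab : ¬ (∀ a ∈ l0, ∀ b ∈ l0, ⁅a, b⁆ = (0 : g0)) := by
      intro hab
      refine h0 (hl.even_eq_bot_of_trivial hred hss hZ0 hab fun x hx v hv => ?_)
      obtain ⟨N, hN, hsum⟩ := hl.exists_annihilated_complement hss
      refine hmin.eq_zero_of_pairing_eq_zero hequiv h0 (hl.2.1 x v hv) fun w => ?_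
      obtain ⟨u, hu, n, hn, rfl⟩ := hsum w
      have h := hequiv x v n
      rw [hab x hx _ (hl.2.2.2 v hv n), hN x hx n hn, map_zero, add_zero] at h
      rw [map_add, hzero _ (hl.2.1 x v hv) u hu, ← h, add_zero]
    have hsimple (i0 : Submodule F g0) (hi : i0 ≤ l0) (hi0 : ∀ a ∈ l0, ∀ x ∈ i0, ⁅a, x⁆ ∈ i0) :
        i0 = ⊥ ∨ i0 = l0 := by
      refine or_iff_not_imp_left.mpr fun hne =>
        (hmin.eq_of_even_ideal hequiv hss (htrans i0 hi hi0) hi hne fun x _ v hv w hw => ?_).1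
      rw [hzero v hv _ (hl.2.1 x w hw)]
      exact zero_mem _
    exact Or.inr (Or.inr ⟨⟨h0, hnab, hsimple⟩, hzero,
      hmin.exists_equiv_adjoint hsymm hequiv hjac hss h0 h1 hzero hnab hsimple⟩)
  · push Not at hK
    refine Or.inl ⟨fun h => h0 (hl.even_eq_bot_of_trivial hred hss hZ0 h.1 h.2.1), ?_⟩
    intro i0 i1 hi0 hi1 hii hiv hxi hbr
    by_cases hne : i0 = ⊥
    · refine Or.inl ⟨hne, (Submodule.eq_bot_iff _).mpr fun v hv => ?_⟩
      by_contra hv0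
      obtain ⟨w, hw, hvw⟩ := hK v (hi1 hv) hv0
      exact hvw ((Submodule.eq_bot_iff _).mp hne _ (hbr v hv w hw))
    · have h := hmin.eq_of_even_ideal hequiv hss (htrans i0 hi0 hii) hi0 hne
        fun x hx v hv w hw => hsymm _ v ▸ hbr _ (hxi x hx w hw) v hv
      exact Or.inr ⟨h.1, le_antisymm hi1 (h.2 ▸ oddBracketSpan_le hxi)⟩
end

section
/- Let g be a quasireductive finite-dimensional Lie superalgebra over F with Z(g)₀ = 0, let l = (l₀, l₁) be a minimal ideal of g, and let i = (i₀, i₁) be an ideal of the Lie superalgebra l, that is: i₀ ⊆ l₀, i₁ ⊆ l₁, [l₀, i₀] ⊆ i₀, l₀ • i₁ ⊆ i₁, i₀ • l₁ ⊆ i₁, and ⟨i₁, l₁⟩ ⊆ i₀. If i₀ ≠ 0, then i = l. -/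
/- STATEMENT 2: if g is quasireductive with Z(g)₀ = 0, l is a minimal ideal of g and
i is an ideal of the Lie superalgebra l with i₀ ≠ 0, then i = l. -/

variable {F : Type} [Field F] [IsAlgClosed F] [CharZero F]
variable {g0 : Type} [LieRing g0] [LieAlgebra F g0] [FiniteDimensional F g0]
variable {g1 : Type} [AddCommGroup g1] [Module F g1] [FiniteDimensional F g1]
variable [LieRingModule g0 g1] [LieModule F g0 g1]

namespace LieAlgebra

open LieModule

variable {K L : Type*} [Field K] [CharZero K] [LieRing L] [LieAlgebra K L] [FiniteDimensional K L]
  [HasCentralRadical K L]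

/-- In a reductive Lie algebra, the center is the kernel of the Killing form. -/
theorem killingCompl_top_eq_center_of_hasCentralRadical :
    LieIdeal.killingCompl K L ⊤ = center K L := by
  apply le_antisymm
  · rw [← radical_eq_center (R := K) (L := L)]
    exact killingCompl_top_le_radical K L
  · have : IsLieAbelian (center K L) := abelian_of_le_center K L _ le_rfl
    exact LieIdeal.le_killingCompl_top_of_isLieAbelian K L _

/-- In a reductive Lie algebra, an ideal containing the center whose Killing complement is central
is the whole algebra. -/
theorem eq_top_of_killingCompl_le_center (N : LieIdeal K L) (hN : center K L ≤ N)
    (h : LieIdeal.killingCompl K L N ≤ center K L) : N = ⊤ := by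
  rw [← LieSubmodule.toSubmodule_eq_top]
  apply Submodule.eq_top_of_finrank_eq
  have hrefl : (killingForm K L).IsRefl := (traceForm_isSymm K L L).isRefl
  have key := LinearMap.BilinForm.finrank_add_finrank_orthogonal hrefl N.toSubmodule
  have htop : (killingForm K L).orthogonal ⊤ = (center K L).toSubmodule :=
    congrArg LieSubmodule.toSubmodule (killingCompl_top_eq_center_of_hasCentralRadical (K := K))
  have hinf : N.toSubmodule ⊓ (center K L).toSubmodule = (center K L).toSubmodule :=
    inf_eq_right.mpr hN
  rw [htop, hinf] at key
  have hle : Module.finrank K ((killingForm K L).orthogonal N.toSubmodule)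
      ≤ Module.finrank K (center K L).toSubmodule := Submodule.finrank_mono h
  have := Submodule.finrank_le N.toSubmodule
  omega

/-- In a reductive Lie algebra, an ideal on which the Killing form vanishes on pairs of an element
and a commutator is central. -/
theorem le_center_of_killingForm_apply_lie_eq_zero (I : LieIdeal K L)
    (h : ∀ x ∈ I, ∀ y ∈ ⁅I, I⁆, killingForm K L x y = 0) : I ≤ center K L := by
  rw [← radical_eq_center (R := K) (L := L), ← LieIdeal.solvable_iff_le_radical]
  exact LieIdeal.isSolvable_of_killingForm_apply_lie_eq_zero I h

theorem center_le_killingCompl (I : LieIdeal K L) :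
    center K L ≤ LieIdeal.killingCompl K L I := by
  rw [← killingCompl_top_eq_center_of_hasCentralRadical]
  intro x hx y _
  exact hx y trivial

theorem inf_killingCompl_le_center (I : LieIdeal K L) :
    I ⊓ LieIdeal.killingCompl K L I ≤ center K L := by
  refine le_center_of_killingForm_apply_lie_eq_zero _ fun x hx y hy ↦ ?_
  exact (LieIdeal.mem_killingCompl K L I).mp (LieSubmodule.lie_le_right _ _ hy).2 x hx.1

theorem sup_killingCompl_eq_top (I : LieIdeal K L) :
    I ⊔ LieIdeal.killingCompl K L I = ⊤ := by
  refine eq_top_of_killingCompl_le_center _ ((center_le_killingCompl I).trans le_sup_right) ?_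
  refine le_trans (fun x hx ↦ ?_) (inf_killingCompl_le_center (LieIdeal.killingCompl K L I))
  exact ⟨fun y hy ↦ hx y ((le_sup_left : I ≤ _) hy),
    fun y hy ↦ hx y ((le_sup_right : LieIdeal.killingCompl K L I ≤ _) hy)⟩

theorem lie_top_sup_center_eq_top :
    ⁅(⊤ : LieIdeal K L), (⊤ : LieIdeal K L)⁆ ⊔ center K L = ⊤ := by
  refine eq_top_of_killingCompl_le_center _ le_sup_right ?_
  refine le_center_of_killingForm_apply_lie_eq_zero _ fun x hx y hy ↦ ?_
  rw [traceForm_comm]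
  refine hx y ((le_sup_left : ⁅(⊤ : LieIdeal K L), (⊤ : LieIdeal K L)⁆ ≤ _) ?_)
  exact LieSubmodule.mono_lie le_top le_top hy

/-- In a reductive Lie algebra, an ideal commutes with its Killing complement. -/
theorem lie_eq_zero_of_mem_killingCompl (I : LieIdeal K L) {x y : L}
    (hx : x ∈ LieIdeal.killingCompl K L I) (hy : y ∈ I) : ⁅x, y⁆ = 0 := by
  have hcomm : ∀ a ∈ I, ∀ b : L, ⁅b, ⁅x, a⁆⁆ = 0 := fun a ha ↦
    inf_killingCompl_le_center I ⟨lie_mem_right K L I x a ha, lie_mem_left K L _ x a hx⟩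
  -- `ad x` kills the derived ideal of `I`, hence all of `I` since `I ≤ ⁅I, I⁆ + center`.
  have hy' : y ∈ ⁅I, I⁆ ⊔ center K L := by
    have htop : (⊤ : LieIdeal K L) ≤ ⁅I, I⁆ ⊔ LieIdeal.killingCompl K L I := by
      rw [← lie_top_sup_center_eq_top, ← sup_killingCompl_eq_top I, LieSubmodule.sup_lie,
        LieSubmodule.lie_sup]
      refine sup_le (sup_le (sup_le_sup_left (LieSubmodule.lie_le_right _ _) _) ?_) ?_
      · exact (LieSubmodule.lie_le_left _ _).trans le_sup_right
      · exact (center_le_killingCompl I).trans le_sup_right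
    obtain ⟨u, hu, c, hc, rfl⟩ := (LieSubmodule.mem_sup _ _ _).mp (htop (LieSubmodule.mem_top y))
    have hcI : c ∈ I := by
      simpa using I.sub_mem hy (LieSubmodule.lie_le_right I I hu)
    exact (LieSubmodule.mem_sup _ _ _).mpr
      ⟨u, hu, c, inf_killingCompl_le_center I ⟨hcI, hc⟩, rfl⟩
  obtain ⟨u, hu, z, hz, rfl⟩ := (LieSubmodule.mem_sup _ _ _).mp hy'
  have hxz : ⁅x, z⁆ = 0 := hz x
  rw [lie_add, hxz, add_zero]
  have hu' : u ∈ (⁅I, I⁆ : LieIdeal K L).toSubmodule := hu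
  rw [LieSubmodule.lieIdeal_oper_eq_linear_span'] at hu'
  refine (Submodule.span_le (p := LinearMap.ker (toEnd K L L x))).mpr ?_ hu'
  rintro - ⟨a, ha, b, hb, rfl⟩
  change ⁅x, ⁅a, b⁆⁆ = 0
  rw [leibniz_lie, ← lie_skew, hcomm a ha b, hcomm b hb a, neg_zero, add_zero]

/-- In a reductive Lie algebra, an ideal of an ideal is an ideal. -/
theorem lie_mem_of_ideal_of_ideal (I : LieIdeal K L) (J : Submodule K L) (hJI : J ≤ I.toSubmodule)
    (hJ : ∀ a ∈ I, ∀ x ∈ J, ⁅a, x⁆ ∈ J) (a : L) {x : L} (hx : x ∈ J) : ⁅a, x⁆ ∈ J := by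
  have ha : a ∈ I ⊔ LieIdeal.killingCompl K L I := by
    rw [sup_killingCompl_eq_top]; trivial
  obtain ⟨b, hb, c, hc, rfl⟩ := (LieSubmodule.mem_sup _ _ _).mp ha
  rw [add_lie, lie_eq_zero_of_mem_killingCompl I hc (hJI hx), add_zero]
  exact hJ b hb x hx

end LieAlgebra

/-- An ideal acting on a semisimple module satisfies `I • (I • M) = I • M`. -/
theorem LieSubmodule.lie_lie_top_eq_lie_top {R L M : Type*} [CommRing R] [LieRing L]
    [LieAlgebra R L] [AddCommGroup M] [Module R M] [LieRingModule L M] [LieModule R L M]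
    (I : LieIdeal R L) (h : ∃ N : LieSubmodule R L M, IsCompl ⁅I, (⊤ : LieSubmodule R L M)⁆ N) :
    ⁅I, ⁅I, (⊤ : LieSubmodule R L M)⁆⁆ = ⁅I, (⊤ : LieSubmodule R L M)⁆ := by
  obtain ⟨N, hN⟩ := h
  have hbot : ⁅I, N⁆ = ⊥ :=
    le_bot_iff.mp <| hN.inf_eq_bot ▸
      le_inf (LieSubmodule.mono_lie_right I le_top) (LieSubmodule.lie_le_right _ _)
  conv_rhs => rw [← hN.sup_eq_top, LieSubmodule.lie_sup, hbot, sup_bot_eq]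

theorem stmt2
    (br : g1 →ₗ[F] g1 →ₗ[F] g0)
    (hsymm : ∀ v w : g1, br v w = br w v)
    (hequiv : ∀ (a : g0) (v w : g1), ⁅a, br v w⁆ = br ⁅a, v⁆ w + br v ⁅a, w⁆)
    (hjac : ∀ u v w : g1, ⁅br u v, w⁆ + ⁅br v w, u⁆ + ⁅br w u, v⁆ = 0)
    (hred : LieAlgebra.radical F g0 = LieAlgebra.center F g0)
    (hss : ∀ N : LieSubmodule F g0 g1, ∃ N', IsCompl N N')
    (hZ0 : ∀ x : g0, (∀ a : g0, ⁅x, a⁆ = 0) → (∀ v : g1, ⁅x, v⁆ = 0) → x = 0)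
    (l0 : Submodule F g0) (l1 : Submodule F g1)
    (hmin : IsMinimalIdeal br l0 l1)
    (i0 : Submodule F g0) (i1 : Submodule F g1)
    (hle0 : i0 ≤ l0) (hle1 : i1 ≤ l1)
    (hbr0 : ∀ a ∈ l0, ∀ x ∈ i0, ⁅a, x⁆ ∈ i0)
    (hact : ∀ a ∈ l0, ∀ v ∈ i1, ⁅a, v⁆ ∈ i1)
    (hodd : ∀ x ∈ i0, ∀ v ∈ l1, ⁅x, v⁆ ∈ i1)
    (hbr1 : ∀ v ∈ i1, ∀ w ∈ l1, br v w ∈ i0)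
    (hne : i0 ≠ ⊥) :
    i0 = l0 ∧ i1 = l1 := by
  obtain ⟨⟨hl0, hl1, hl01, hl10⟩, -, hmin⟩ := hmin
  have : LieAlgebra.HasCentralRadical F g0 := ⟨hred⟩
  let l : LieIdeal F g0 := { l0 with lie_mem := fun {a x} hx ↦ hl0 a x hx }
  let I : LieIdeal F g0 :=
    { i0 with lie_mem := fun {a _} hx ↦ LieAlgebra.lie_mem_of_ideal_of_ideal l i0 hle0 hbr0 a hx }
  let J : LieSubmodule F g0 g1 := ⁅I, (⊤ : LieSubmodule F g0 g1)⁆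
  have hIJ : ⁅I, J⁆ = J := LieSubmodule.lie_lie_top_eq_lie_top I (hss _)
  have hJl1 : J.toSubmodule ≤ l1 := by
    rw [LieSubmodule.lieIdeal_oper_eq_linear_span', Submodule.span_le]
    rintro - ⟨x, hx, v, -, rfl⟩
    exact hl01 x (hle0 hx) v
  have hJspan : J.toSubmodule ≤ Submodule.span F {⁅x, v⁆ | (x ∈ I) (v ∈ l1)} := by
    rw [← hIJ, LieSubmodule.lieIdeal_oper_eq_linear_span']
    refine Submodule.span_mono ?_
    rintro - ⟨x, hx, v, hv, rfl⟩
    exact ⟨x, hx, v, hJl1 hv, rfl⟩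
  have hJi1 : J.toSubmodule ≤ i1 := by
    refine hJspan.trans (Submodule.span_le.mpr ?_)
    rintro - ⟨x, hx, v, hv, rfl⟩
    exact hodd x hx v hv
  have hJbr : ∀ v ∈ J.toSubmodule, ∀ w : g1, br v w ∈ i0 := by
    intro v hv w
    refine (Submodule.span_le (p := i0.comap (br.flip w))).mpr ?_ (hJspan hv)
    rintro - ⟨x, hx, v, hv, rfl⟩
    have hxw : ⁅x, w⁆ ∈ i1 := hJi1 (LieSubmodule.lie_mem_lie hx (LieSubmodule.mem_top w))
    have h : br ⁅x, v⁆ w = ⁅x, br v w⁆ - br ⁅x, w⁆ v := by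
      rw [hequiv, hsymm v, add_sub_cancel_right]
    change br ⁅x, v⁆ w ∈ i0
    rw [h]
    exact i0.sub_mem (lie_mem_left F g0 I x _ hx) (hbr1 _ hxw v hv)
  have hideal : IsIdeal br i0 J.toSubmodule :=
    ⟨fun a _ hx ↦ I.lie_mem hx, fun a _ hv ↦ J.lie_mem hv,
      fun x hx v ↦ LieSubmodule.lie_mem_lie (I := I) hx (LieSubmodule.mem_top v), hJbr⟩
  obtain ⟨h0, h1⟩ := hmin i0 J.toSubmodule hideal hle0 hJl1 (Or.inl hne)
  exact ⟨h0, le_antisymm hle1 (h1 ▸ hJi1)⟩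
end

section
/- Let g be a quasireductive finite-dimensional Lie superalgebra over F and let (D₀, D₁) be an even derivation of g. Then there exists x ∈ g₀ such that the pair (D₀ − ad x, D₁ − (x • ·)) is g₀-invariant, meaning (D₀ − ad x)([a,b]) = [a, (D₀ − ad x)(b)] for all a, b ∈ g₀ and (D₁ − (x • ·))(a • v) = a • (D₁ − (x • ·))(v) for all a ∈ g₀, v ∈ g₁. (In other words, Der(g) = Der(g)^{g₀} + ad(g) on even derivations.) -/
/- STATEMENT 3: every even derivation of a quasireductive finite-dimensional Lie superalgebra
becomes g₀-invariant after subtracting an inner derivation ad x. -/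

variable {F : Type} [Field F] [IsAlgClosed F] [CharZero F]
variable {g0 : Type} [LieRing g0] [LieAlgebra F g0] [FiniteDimensional F g0]
variable {g1 : Type} [AddCommGroup g1] [Module F g1] [FiniteDimensional F g1]
variable [LieRingModule g0 g1] [LieModule F g0 g1]

/-- An element of the center of a Lie algebra acts by an endomorphism `f` with
`ker (f - c) ^ 2 = ker (f - c)` on a module in which every submodule has a complement. -/
theorem LieModule.sub_smul_eq_zero_of_mem_center {K L M : Type*} [Field K] [LieRing L]
    [LieAlgebra K L] [AddCommGroup M] [Module K M] [LieRingModule L M] [LieModule K L M]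
    (hss : ∀ N : LieSubmodule K L M, ∃ N', IsCompl N N')
    {z : L} (hz : ∀ a : L, ⁅a, z⁆ = 0) (c : K) {v : M}
    (hv : ⁅z, ⁅z, v⁆ - c • v⁆ - c • (⁅z, v⁆ - c • v) = 0) : ⁅z, v⁆ - c • v = 0 := by
  let N : LieSubmodule K L M :=
    { LinearMap.ker (LieModule.toEnd K L M z - c • LinearMap.id) with
      lie_mem := by
        intro a m hm
        have hm' : ⁅z, m⁆ - c • m = 0 := by simpa using hm
        have h := leibniz_lie a z m
        rw [hz, zero_lie, zero_add, sub_eq_zero.mp hm', lie_smul] at h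
        simp [← h] }
  have mem_N (m : M) : m ∈ N ↔ ⁅z, m⁆ - c • m = 0 := by
    change m ∈ LinearMap.ker (LieModule.toEnd K L M z - c • LinearMap.id) ↔ _
    simp
  obtain ⟨N', hN⟩ := hss N
  obtain ⟨n, hn, n', hn', rfl⟩ :=
    (LieSubmodule.mem_sup N N' v).mp (hN.sup_eq_top ▸ LieSubmodule.mem_top v)
  have key : ⁅z, n + n'⁆ - c • (n + n') = ⁅z, n'⁆ - c • n' := by
    rw [lie_add, smul_add, add_sub_add_comm, (mem_N n).mp hn, zero_add]
  rw [key] at hv ⊢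
  have h : ⁅z, n'⁆ - c • n' ∈ N ⊓ N' :=
    ⟨(mem_N _).mpr hv, sub_mem (N'.lie_mem hn') (N'.smul_mem c hn')⟩
  rwa [hN.inf_eq_bot, LieSubmodule.mem_bot] at h

/-- If the commutator of an endomorphism `D` with the action of a central element `z` is the
action of a central element `w`, then `w` acts trivially. -/
theorem LieModule.lie_eq_zero_of_commutator {K L M : Type*} [Field K] [IsAlgClosed K] [LieRing L]
    [LieAlgebra K L] [AddCommGroup M] [Module K M] [FiniteDimensional K M]
    [LieRingModule L M] [LieModule K L M]
    (hss : ∀ N : LieSubmodule K L M, ∃ N', IsCompl N N')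
    {z w : L} (hz : ∀ a : L, ⁅a, z⁆ = 0) (D : M →ₗ[K] M)
    (hD : ∀ v : M, D ⁅z, v⁆ = ⁅w, v⁆ + ⁅z, D v⁆) (v : M) : ⁅w, v⁆ = 0 := by
  let f : Module.End K M := LieModule.toEnd K L M z
  have hw (c : K) (m : M) (hm : ⁅z, m⁆ - c • m = 0) : ⁅w, m⁆ = 0 := by
    have hDm : ⁅z, D m⁆ - c • D m = -⁅w, m⁆ := by
      have h := hD m
      rw [sub_eq_zero.mp hm, map_smul] at h
      rw [h]
      abel
    have hwm : ⁅z, ⁅w, m⁆⁆ - c • ⁅w, m⁆ = 0 := by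
      have h := leibniz_lie w z m
      rw [hz, zero_lie, zero_add, sub_eq_zero.mp hm, lie_smul] at h
      rw [h, sub_self]
    have h := LieModule.sub_smul_eq_zero_of_mem_center hss hz c (v := D m) (by
      rw [hDm, lie_neg, smul_neg, ← neg_sub', hwm, neg_zero])
    rwa [hDm, neg_eq_zero] at h
  have hpow (c : K) (k : ℕ) (m : M) (hm : ((f - c • 1) ^ k) m = 0) : ⁅z, m⁆ - c • m = 0 := by
    induction k generalizing m with
    | zero =>
      have : m = 0 := by simpa using hm
      simp [this]
    | succ k ih =>
      rw [pow_succ, Module.End.mul_apply] at hm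
      exact LieModule.sub_smul_eq_zero_of_mem_center hss hz c (ih _ hm)
  have htop : (⨆ c : K, f.maxGenEigenspace c) ≤ LinearMap.ker (LieModule.toEnd K L M w) := by
    refine iSup_le fun c m hm => ?_
    obtain ⟨k, hk⟩ := (Module.End.mem_maxGenEigenspace f c m).mp hm
    exact hw c m (hpow c k m hk)
  rw [Module.End.iSup_maxGenEigenspace_eq_top] at htop
  exact htop (Submodule.mem_top (x := v))

/-- The canonical homomorphism from a Lie algebra to its quotient by an ideal. -/
def LieIdeal.quotientHom {K L : Type*} [CommRing K] [LieRing L] [LieAlgebra K L]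
    (I : LieIdeal K L) : L →ₗ⁅K⁆ L ⧸ I :=
  { (LieSubmodule.Quotient.mk' I : L →ₗ[K] L ⧸ I) with
    map_lie' := fun {x y} => LieSubmodule.Quotient.mk_bracket _ x y }

theorem LieIdeal.quotientHom_surjective {K L : Type*} [CommRing K] [LieRing L] [LieAlgebra K L]
    (I : LieIdeal K L) : Function.Surjective I.quotientHom :=
  LieSubmodule.Quotient.surjective_mk' I

theorem LieIdeal.quotientHom_eq_zero_iff {K L : Type*} [CommRing K] [LieRing L] [LieAlgebra K L]
    (I : LieIdeal K L) (x : L) : I.quotientHom x = 0 ↔ x ∈ I :=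
  LieSubmodule.Quotient.mk_eq_zero I

/-- The quotient of a reductive Lie algebra by its center has trivial radical. -/
theorem LieAlgebra.hasTrivialRadical_quotient_center {K L : Type*} [Field K] [LieRing L]
    [LieAlgebra K L] [FiniteDimensional K L]
    (hred : LieAlgebra.radical K L = LieAlgebra.center K L) :
    LieAlgebra.HasTrivialRadical K (L ⧸ LieAlgebra.center K L) := by
  set Z := LieAlgebra.center K L
  rw [LieAlgebra.hasTrivialRadical_iff_no_abelian_ideals]
  intro I hI
  let J : LieIdeal K L := I.comap Z.quotientHom
  have hJ : LieAlgebra.derivedSeriesOfIdeal K L 1 J ≤ Z := by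
    rw [LieAlgebra.derivedSeriesOfIdeal_succ, LieAlgebra.derivedSeriesOfIdeal_zero,
      LieSubmodule.lieIdeal_oper_eq_span, LieSubmodule.lieSpan_le]
    rintro _ ⟨⟨x, hx⟩, ⟨y, hy⟩, rfl⟩
    refine (Z.quotientHom_eq_zero_iff _).mp ?_
    rw [LieIdeal.mem_comap] at hx hy
    have h := congrArg Subtype.val (hI.trivial ⟨_, hx⟩ ⟨_, hy⟩)
    rw [LieHom.map_lie]
    exact h
  have hJ2 : LieAlgebra.derivedSeriesOfIdeal K L 2 J = ⊥ := by
    rw [LieAlgebra.derivedSeriesOfIdeal_succ, eq_bot_iff, LieSubmodule.lieIdeal_oper_eq_span,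
      LieSubmodule.lieSpan_le]
    rintro _ ⟨⟨x, hx⟩, ⟨y, hy⟩, rfl⟩
    exact (LieModule.mem_maxTrivSubmodule K L L y).mp (hJ hy) x
  have : LieAlgebra.IsSolvable J :=
    LieAlgebra.IsSolvable.mk (R := K) ((LieIdeal.derivedSeries_eq_bot_iff J 2).mpr hJ2)
  have hle : J ≤ Z := hred ▸ (LieIdeal.solvable_iff_le_radical K L J).mp this
  rw [eq_bot_iff]
  intro q hq
  obtain ⟨x, rfl⟩ := Z.quotientHom_surjective q
  exact (Z.quotientHom_eq_zero_iff x).mpr (hle (LieIdeal.mem_comap.mpr hq))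

/-- A Lie algebra with nondegenerate Killing form is perfect. -/
theorem LieAlgebra.IsKilling.lie_top_eq_top {K L : Type*} [Field K] [LieRing L]
    [LieAlgebra K L] [FiniteDimensional K L] [LieAlgebra.IsKilling K L] :
    ⁅(⊤ : LieIdeal K L), (⊤ : LieIdeal K L)⁆ = ⊤ := by
  set P : LieIdeal K L := ⁅(⊤ : LieIdeal K L), (⊤ : LieIdeal K L)⁆
  have hP := P.isCompl_killingCompl
  have hC : IsLieAbelian (LieIdeal.killingCompl K L P) := by
    refine ⟨fun x y => Subtype.ext ?_⟩
    have h : ⁅(x : L), (y : L)⁆ ∈ P ⊓ LieIdeal.killingCompl K L P :=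
      ⟨LieSubmodule.lie_mem_lie (LieSubmodule.mem_top _) (LieSubmodule.mem_top _),
        LieSubmodule.lie_mem _ y.2⟩
    rw [hP.inf_eq_bot] at h
    exact h
  have h := hP.sup_eq_top
  rwa [LieAlgebra.IsKilling.ideal_eq_bot_of_isLieAbelian (LieIdeal.killingCompl K L P),
    sup_bot_eq] at h

/-- A derivation of a reductive Lie algebra is the sum of an inner derivation and a linear map
with values in the center. -/
theorem LieDerivation.exists_sub_ad_mem_center {K L : Type*} [Field K] [CharZero K] [LieRing L]
    [LieAlgebra K L] [FiniteDimensional K L]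
    (hred : LieAlgebra.radical K L = LieAlgebra.center K L) (D : LieDerivation K L L) :
    ∃ x : L, ∀ a : L, D a - ⁅x, a⁆ ∈ LieAlgebra.center K L := by
  have := LieAlgebra.hasTrivialRadical_quotient_center hred
  set Z := LieAlgebra.center K L
  let π := Z.quotientHom
  have hDZ : Z.toSubmodule ≤ Z.toSubmodule.comap (D : L →ₗ[K] L) := by
    intro z hz
    refine (LieModule.mem_maxTrivSubmodule K L L (D z)).mpr fun a => ?_
    have hz' := (LieModule.mem_maxTrivSubmodule K L L z).mp hz
    have h := D.apply_lie_eq_add a z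
    rw [hz', hz', map_zero, add_zero] at h
    exact h.symm
  let Dq : LieDerivation K (L ⧸ Z) (L ⧸ Z) :=
    { Submodule.mapQ Z.toSubmodule Z.toSubmodule (D : L →ₗ[K] L) hDZ with
      leibniz' := by
        intro p q
        obtain ⟨a, rfl⟩ := Z.quotientHom_surjective p
        obtain ⟨b, rfl⟩ := Z.quotientHom_surjective q
        change π (D ⁅a, b⁆) = ⁅π a, π (D b)⁆ - ⁅π b, π (D a)⁆
        rw [D.apply_lie_eq_sub, map_sub, LieHom.map_lie, LieHom.map_lie] }
  obtain ⟨q, hq⟩ := LieDerivation.IsKilling.exists_eq_ad Dq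
  obtain ⟨x, rfl⟩ := Z.quotientHom_surjective q
  refine ⟨x, fun a => (Z.quotientHom_eq_zero_iff _).mp ?_⟩
  have h : ⁅π x, π a⁆ = π (D a) := by
    rw [← LieDerivation.ad_apply_apply (R := K), hq]
    rfl
  rw [map_sub, LieHom.map_lie]
  exact sub_eq_zero.mpr h.symm

/-- A linear map on a reductive Lie algebra killing all brackets has the same range as its
restriction to the center. -/
theorem LieAlgebra.exists_mem_center_apply_eq {K L V : Type*} [Field K] [CharZero K] [LieRing L]
    [LieAlgebra K L] [FiniteDimensional K L] [AddCommGroup V] [Module K V]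
    (hred : LieAlgebra.radical K L = LieAlgebra.center K L) (E : L →ₗ[K] V)
    (hE : ∀ a b : L, E ⁅a, b⁆ = 0) (a : L) : ∃ z ∈ LieAlgebra.center K L, E z = E a := by
  have := LieAlgebra.hasTrivialRadical_quotient_center hred
  set Z := LieAlgebra.center K L
  have key (q : L ⧸ Z) : ∃ b : L, Z.quotientHom b = q ∧ E b = 0 := by
    have hq : q ∈ ⁅(⊤ : LieIdeal K (L ⧸ Z)), (⊤ : LieIdeal K (L ⧸ Z))⁆ := by
      rw [LieAlgebra.IsKilling.lie_top_eq_top]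
      exact LieSubmodule.mem_top q
    rw [← LieSubmodule.mem_toSubmodule, LieSubmodule.lieIdeal_oper_eq_linear_span'] at hq
    induction hq using Submodule.span_induction with
    | mem q hq =>
      obtain ⟨p, -, r, -, rfl⟩ := hq
      obtain ⟨b, rfl⟩ := Z.quotientHom_surjective p
      obtain ⟨c, rfl⟩ := Z.quotientHom_surjective r
      exact ⟨⁅b, c⁆, LieHom.map_lie _ b c, hE b c⟩
    | zero => exact ⟨0, map_zero _, map_zero E⟩
    | add p r _ _ hp hr =>
      obtain ⟨b, rfl, hb⟩ := hp
      obtain ⟨c, rfl, hc⟩ := hr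
      exact ⟨b + c, map_add _ b c, by rw [map_add, hb, hc, add_zero]⟩
    | smul t p _ hp =>
      obtain ⟨b, rfl, hb⟩ := hp
      exact ⟨t • b, map_smul _ t b, by rw [map_smul, hb, smul_zero]⟩
  obtain ⟨b, hb, hEb⟩ := key (Z.quotientHom a)
  exact ⟨a - b, (Z.quotientHom_eq_zero_iff _).mp (by rw [map_sub, hb, sub_self]),
    by rw [map_sub, hEb, sub_zero]⟩

theorem stmt3
    (br : g1 →ₗ[F] g1 →ₗ[F] g0)
    (hsymm : ∀ v w : g1, br v w = br w v)
    (hequiv : ∀ (a : g0) (v w : g1), ⁅a, br v w⁆ = br ⁅a, v⁆ w + br v ⁅a, w⁆)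
    (hjac : ∀ u v w : g1, ⁅br u v, w⁆ + ⁅br v w, u⁆ + ⁅br w u, v⁆ = 0)
    (hred : LieAlgebra.radical F g0 = LieAlgebra.center F g0)
    (hss : ∀ N : LieSubmodule F g0 g1, ∃ N', IsCompl N N')
    (D0 : g0 →ₗ[F] g0) (D1 : g1 →ₗ[F] g1)
    (hD0 : ∀ a b : g0, D0 ⁅a, b⁆ = ⁅D0 a, b⁆ + ⁅a, D0 b⁆)
    (hD1 : ∀ (a : g0) (v : g1), D1 ⁅a, v⁆ = ⁅D0 a, v⁆ + ⁅a, D1 v⁆)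
    (hDbr : ∀ v w : g1, D0 (br v w) = br (D1 v) w + br v (D1 w)) :
    ∃ x : g0,
      (∀ a b : g0, D0 ⁅a, b⁆ - ⁅x, ⁅a, b⁆⁆ = ⁅a, D0 b - ⁅x, b⁆⁆) ∧
      (∀ (a : g0) (v : g1), D1 ⁅a, v⁆ - ⁅x, ⁅a, v⁆⁆ = ⁅a, D1 v - ⁅x, v⁆⁆) := by
  have mem_center (z : g0) : z ∈ LieAlgebra.center F g0 ↔ ∀ a : g0, ⁅a, z⁆ = 0 :=
    LieModule.mem_maxTrivSubmodule F g0 g0 z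
  let D : LieDerivation F g0 g0 :=
    { D0 with
      leibniz' := fun a b => by
        change D0 ⁅a, b⁆ = ⁅a, D0 b⁆ - ⁅b, D0 a⁆
        rw [hD0, ← lie_skew b (D0 a)]
        abel }
  obtain ⟨x, hx⟩ := D.exists_sub_ad_mem_center hred
  let E0 : g0 →ₗ[F] g0 := D0 - LieAlgebra.ad F g0 x
  let E1 : g1 →ₗ[F] g1 := D1 - LieModule.toEnd F g0 g1 x
  have hE0 (a b : g0) : E0 ⁅a, b⁆ = ⁅E0 a, b⁆ + ⁅a, E0 b⁆ := by
    change D0 ⁅a, b⁆ - ⁅x, ⁅a, b⁆⁆ = ⁅D0 a - ⁅x, a⁆, b⁆ + ⁅a, D0 b - ⁅x, b⁆⁆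
    rw [hD0, leibniz_lie x a b, sub_lie, lie_sub]
    abel
  have hE1 (a : g0) (v : g1) : E1 ⁅a, v⁆ = ⁅E0 a, v⁆ + ⁅a, E1 v⁆ := by
    change D1 ⁅a, v⁆ - ⁅x, ⁅a, v⁆⁆ = ⁅D0 a - ⁅x, a⁆, v⁆ + ⁅a, D1 v - ⁅x, v⁆⁆
    rw [hD1, leibniz_lie x a v, sub_lie, lie_sub]
    abel
  have hcent (a b : g0) : ⁅b, E0 a⁆ = 0 := (mem_center _).mp (hx a) b
  have hcent' (a b : g0) : ⁅E0 a, b⁆ = 0 := by rw [← lie_skew, hcent, neg_zero]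
  have htriv (a : g0) (v : g1) : ⁅E0 a, v⁆ = 0 := by
    obtain ⟨z, hz, hza⟩ := LieAlgebra.exists_mem_center_apply_eq hred E0
      (fun a b => by rw [hE0, hcent, hcent', add_zero]) a
    rw [← hza]
    exact LieModule.lie_eq_zero_of_commutator hss ((mem_center z).mp hz) E1 (hE1 z) v
  refine ⟨x, fun a b => ?_, fun a v => ?_⟩
  · exact (hE0 a b).trans (by rw [hcent', zero_add]; rfl)
  · exact (hE1 a v).trans (by rw [htriv, zero_add]; rfl)
end

section
/- Let g be a quasireductive finite-dimensional Lie superalgebra over F and let (E, F) be an odd derivation of g. Then there exists u ∈ g₁ such that the maps E'(a) := E(a) + a • u and F'(v) := F(v) − ⟨u, v⟩ satisfy E'([a,b]) = a • E'(b) and F'(a • v) = [a, F'(v)] for all a, b ∈ g₀ and v ∈ g₁ (i.e. (E', F') is a g₀-invariant odd derivation, so every odd derivation is the sum of an inner odd derivation and a g₀-invariant one). -/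
section Casimir

open LieModule

variable {K L N : Type*} [Field K] [LieRing L] [LieAlgebra K L]
  [AddCommGroup N] [Module K N] [LieRingModule L N] [LieModule K L N]

theorem LinearMap.BilinForm.sum_lie_dualBasis_eq_zero {ι : Type*} [Fintype ι] [DecidableEq ι]
    {I : LieIdeal K L} {B : LinearMap.BilinForm K I} (hB : B.Nondegenerate)
    (hinv : ∀ (x : L) (y z : I), B ⁅x, y⁆ z = -B y ⁅x, z⁆)
    (b : Module.Basis ι K I) {P : Type*} [AddCommGroup P] [Module K P]
    (φ : I →ₗ[K] I →ₗ[K] P) (x : L) :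
    ∑ i, (φ ⁅x, b i⁆ (B.dualBasis hB b i) + φ (b i) ⁅x, B.dualBasis hB b i⁆) = 0 := by
  set d := B.dualBasis hB b with hd
  have h1 (y : I) : y = ∑ j, B (d j) y • b j := by
    conv_lhs => rw [← b.sum_repr y]
    refine Finset.sum_congr rfl fun j _ ↦ ?_
    congr 1
    conv_rhs => rw [← b.sum_repr y]
    simp only [map_sum, map_smul, hd, LinearMap.BilinForm.apply_dualBasis_left]
    simp
  have h2 (y : I) : y = ∑ j, B y (b j) • d j := by
    conv_lhs => rw [← d.sum_repr y]
    simp [hd]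
  have e1 (i : ι) : φ ⁅x, b i⁆ (d i) = ∑ j, B (d j) ⁅x, b i⁆ • φ (b j) (d i) := by
    conv_lhs => rw [h1 ⁅x, b i⁆]
    simp
  have e2 (i : ι) : φ (b i) ⁅x, d i⁆ = ∑ j, B ⁅x, d i⁆ (b j) • φ (b i) (d j) := by
    conv_lhs => rw [h2 ⁅x, d i⁆]
    simp
  rw [Finset.sum_add_distrib]
  simp_rw [e1, e2]
  rw [Finset.sum_comm, ← Finset.sum_add_distrib]
  refine Finset.sum_eq_zero fun i _ ↦ ?_
  rw [← Finset.sum_add_distrib]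
  refine Finset.sum_eq_zero fun j _ ↦ ?_
  rw [hinv, neg_smul, add_neg_cancel]

theorem LieModule.exists_eq_lie_of_nondegenerate [CharZero K] [FiniteDimensional K L]
    [FiniteDimensional K N] [IsIrreducible K L N] (I : LieIdeal K L) (hI : I ≠ ⊥)
    (hB : ((traceForm K L N).restrict I.toSubmodule).Nondegenerate) (f : L →ₗ[K] N)
    (hf : ∀ x y, f ⁅x, y⁆ = ⁅x, f y⁆ - ⁅y, f x⁆) :
    ∃ u : N, ∀ x, f x = ⁅x, u⁆ := by
  let B : LinearMap.BilinForm K I := (traceForm K L N).restrict I.toSubmodule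
  have hBn : B.Nondegenerate := hB
  have hinv (x : L) (y z : I) : B ⁅x, y⁆ z = -B y ⁅x, z⁆ :=
    traceForm_lieInvariant K L N x y z
  let b := Module.finBasis K I
  let d := B.dualBasis hBn b
  let incl : I →ₗ[K] L := I.toSubmodule.subtype
  let ψ : L →ₗ[K] N →ₗ[K] N := (toEnd K L N : L →ₗ[K] Module.End K N)
  let C : Module.End K N := ∑ i, toEnd K L N (b i) * toEnd K L N (d i)
  have hC (n : N) : C n = ∑ i, ⁅(b i : L), ⁅(d i : L), n⁆⁆ := by simp [C]
  have hCx (x : L) (n : N) : ⁅x, C n⁆ = C ⁅x, n⁆ := by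
    have key := LinearMap.BilinForm.sum_lie_dualBasis_eq_zero hBn hinv b
      ((ψ.comp incl).compl₂ ((ψ.comp incl).flip n)) x
    have e : ∑ i, (⁅⁅x, (b i : L)⁆, ⁅(d i : L), n⁆⁆ + ⁅(b i : L), ⁅⁅x, (d i : L)⁆, n⁆⁆) = 0 := key
    rw [hC, hC, ← sub_eq_zero, ← e, lie_sum, ← Finset.sum_sub_distrib]
    refine Finset.sum_congr rfl fun i _ ↦ ?_
    simp only [lie_lie, lie_sub]
    abel
  let w : N := ∑ i, ⁅(b i : L), f (d i)⁆
  have hw (x : L) : ⁅x, w⁆ = C (f x) := by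
    have key := LinearMap.BilinForm.sum_lie_dualBasis_eq_zero hBn hinv b
      ((ψ.comp incl).compl₂ (f.comp incl)) x
    have e : ∑ i, (⁅⁅x, (b i : L)⁆, f (d i)⁆ + ⁅(b i : L), f ⁅x, (d i : L)⁆⁆) = 0 := key
    rw [hC, ← sub_eq_zero, ← e, lie_sum, ← Finset.sum_sub_distrib]
    refine Finset.sum_congr rfl fun i _ ↦ ?_
    simp only [lie_lie, lie_sub, hf]
    abel
  have htr : LinearMap.trace K N C ≠ 0 := by
    have hsymm : B.IsSymm := ⟨fun y z ↦ traceForm_comm K L N y z⟩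
    have : LinearMap.trace K N C = ∑ i, B (b i) (d i) := by
      rw [map_sum]
      rfl
    rw [this]
    simp only [d, LinearMap.BilinForm.apply_dualBasis_right hBn hsymm]
    simp only [if_true, Finset.sum_const, Finset.card_univ, Fintype.card_fin, nsmul_eq_mul,
      mul_one, ne_eq, Nat.cast_eq_zero]
    intro h0
    apply hI
    rw [← LieSubmodule.toSubmodule_eq_bot]
    exact Submodule.finrank_eq_zero.mp h0
  let T : N →ₗ⁅K, L⁆ N := { C with map_lie' := fun {x n} ↦ (hCx x n).symm }
  have hker : T.ker = ⊥ := by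
    refine (eq_bot_or_eq_top T.ker).resolve_right fun h ↦ htr ?_
    have : C = 0 := by
      ext n
      have : n ∈ T.ker := h ▸ LieSubmodule.mem_top n
      exact this
    simp [this]
  have hinj : Function.Injective C := by
    exact (LieModuleHom.ker_eq_bot T).mp hker
  obtain ⟨u, hu⟩ := LinearMap.injective_iff_surjective.mp hinj w
  exact ⟨u, fun x ↦ hinj <| by rw [← hCx, hu, hw]⟩

end Casimir

theorem LieAlgebra.lie_top_top_eq_top {K L : Type*} [Field K] [LieRing L] [LieAlgebra K L]
    [LieAlgebra.IsSemisimple K L] :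
    (⁅(⊤ : LieIdeal K L), (⊤ : LieIdeal K L)⁆ : LieIdeal K L) = ⊤ := by
  obtain ⟨J, hJ⟩ := exists_isCompl (⁅(⊤ : LieIdeal K L), (⊤ : LieIdeal K L)⁆ : LieIdeal K L)
  have h1 : ⁅J, J⁆ = (⊥ : LieIdeal K L) := by
    rw [eq_bot_iff, ← hJ.inf_eq_bot]
    exact le_inf (LieSubmodule.mono_lie le_top le_top) (LieSubmodule.lie_le_left _ _)
  have h2 : IsLieAbelian J := (LieSubmodule.lie_abelian_iff_lie_self_eq_bot J).mpr h1
  have h3 : J = ⊥ := LieAlgebra.HasTrivialRadical.eq_bot_of_isSolvable J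
  simpa [h3] using hJ.sup_eq_top

section Semisimple

open LieModule

variable {K L N : Type*} [Field K] [CharZero K] [LieRing L] [LieAlgebra K L]
  [AddCommGroup N] [Module K N] [LieRingModule L N] [LieModule K L N] [FiniteDimensional K N]

theorem LieModule.traceForm_restrict_nondegenerate [LieAlgebra.IsSemisimple K L]
    [IsIrreducible K L N] (I : LieIdeal K L) (hI : IsAtom I)
    (hIN : ∃ x ∈ I, ∃ n : N, ⁅x, n⁆ ≠ 0) :
    ((traceForm K L N).restrict I.toSubmodule).Nondegenerate := by
  have hrefl : ((traceForm K L N).restrict I.toSubmodule).IsRefl := fun y z h ↦ by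
    have h' : traceForm K L N y z = 0 := h
    rw [traceForm_comm] at h'
    exact h'
  refine (LinearMap.IsRefl.nondegenerate_iff_separatingLeft hrefl).mpr ?_
  let O := LieAlgebra.InvariantForm.orthogonal (traceForm K L N) (traceForm_lieInvariant K L N) I
  rcases hI.le_iff.mp (inf_le_left : I ⊓ O ≤ I) with h | h
  · intro y hy
    have : (y : L) ∈ I ⊓ O := by
      refine ⟨y.2, (LieAlgebra.InvariantForm.mem_orthogonal _ _ _ _).mpr fun x hx ↦ ?_⟩
      rw [traceForm_comm]
      exact hy ⟨x, hx⟩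
    rw [h] at this
    exact Subtype.ext ((LieSubmodule.mem_bot _).mp this)
  · exfalso
    have htf : traceForm K I N = 0 := by
      ext y z
      have hz : (z : L) ∈ O := inf_eq_left.mp h z.2
      exact (LieAlgebra.InvariantForm.mem_orthogonal _ _ _ _).mp hz y y.2
    have hnil := isNilpotent_derivedSeries_of_traceForm_eq_zero htf
    have := nontrivial_of_isIrreducible K L N
    have hnt := nontrivial_max_triv_of_isNilpotent K (LieAlgebra.derivedSeries K I 1) N
    let D : LieIdeal K L := ⁅I, I⁆
    let W : LieSubmodule K L N :=
      { carrier := {n | ∀ y ∈ D, ⁅y, n⁆ = 0}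
        add_mem' := fun ha hb y hy ↦ by rw [lie_add, ha y hy, hb y hy, add_zero]
        zero_mem' := fun y _ ↦ lie_zero y
        smul_mem' := fun c n hn y hy ↦ by rw [lie_smul, hn y hy, smul_zero]
        lie_mem := fun {x n} hn y hy ↦ by
          rw [leibniz_lie, hn y hy, lie_zero, add_zero]
          exact hn _ (lie_mem_left K L D y x hy) }
    have hW : W ≠ ⊥ := by
      obtain ⟨⟨n, hn⟩, hn0⟩ := exists_ne
        (0 : maxTrivSubmodule K (LieAlgebra.derivedSeries K I 1) N)
      intro hbot
      have hnW : n ∈ W := fun y hy ↦ by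
        have hyI : y ∈ I := LieSubmodule.lie_le_left I I hy
        have hyD : (⟨y, hyI⟩ : I) ∈ LieAlgebra.derivedSeries K I 1 := by
          rw [LieIdeal.derivedSeries_eq_derivedSeriesOfIdeal_comap, LieIdeal.mem_comap]
          exact hy
        exact (mem_maxTrivSubmodule K _ N n).mp hn ⟨⟨y, hyI⟩, hyD⟩
      rw [hbot] at hnW
      exact hn0 (Subtype.ext ((LieSubmodule.mem_bot _).mp hnW))
    have hWtop : W = ⊤ := (eq_bot_or_eq_top W).resolve_left hW
    rcases hI.le_iff.mp (LieSubmodule.lie_le_left I I : D ≤ I) with hD | hD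
    · exact LieAlgebra.IsSemisimple.non_abelian_of_isAtom I hI
        ((LieSubmodule.lie_abelian_iff_lie_self_eq_bot I).mpr hD)
    · obtain ⟨x, hx, n, hxn⟩ := hIN
      have hn : n ∈ W := hWtop ▸ LieSubmodule.mem_top n
      exact hxn (hn x (hD.ge hx))

variable [FiniteDimensional K L]

/-- **Whitehead's first lemma** for nontrivial irreducible modules. -/
theorem LieModule.exists_eq_lie_of_isIrreducible [LieAlgebra.IsSemisimple K L]
    [IsIrreducible K L N] (hN : ¬ IsTrivial L N) (f : L →ₗ[K] N)
    (hf : ∀ x y, f ⁅x, y⁆ = ⁅x, f y⁆ - ⁅y, f x⁆) :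
    ∃ u : N, ∀ x, f x = ⁅x, u⁆ := by
  obtain ⟨I, hI, hIN⟩ : ∃ I : LieIdeal K L, IsAtom I ∧ ∃ x ∈ I, ∃ n : N, ⁅x, n⁆ ≠ 0 := by
    by_contra! h
    let A : LieIdeal K L :=
      { carrier := {x | ∀ n : N, ⁅x, n⁆ = 0}
        add_mem' := fun ha hb n ↦ by rw [add_lie, ha n, hb n, add_zero]
        zero_mem' := fun n ↦ zero_lie n
        smul_mem' := fun c x hx n ↦ by rw [smul_lie, hx n, smul_zero]
        lie_mem := fun {y x} hx n ↦ by rw [lie_lie, hx n, hx, lie_zero, sub_zero] }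
    have htop : (⊤ : LieIdeal K L) ≤ A := by
      rw [← LieAlgebra.IsSemisimple.sSup_atoms_eq_top (R := K) (L := L)]
      exact sSup_le fun I hI x hx ↦ h I hI x hx
    exact hN ⟨fun x n ↦ htop (LieSubmodule.mem_top x) n⟩
  exact exists_eq_lie_of_nondegenerate I hI.1 (traceForm_restrict_nondegenerate I hI hIN) f hf

end Semisimple

section Reductive

open LieModule

variable {K L N : Type*} [Field K] [LieRing L] [LieAlgebra K L]

/-- The quotient map onto the quotient by the center, as a morphism of Lie algebras. -/
def LieAlgebra.mkCenter (K L : Type*) [Field K] [LieRing L] [LieAlgebra K L] :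
    L →ₗ⁅K⁆ L ⧸ center K L :=
  { (LieSubmodule.Quotient.mk' (center K L) : L →ₗ[K] L ⧸ center K L) with
    map_lie' := fun {x y} ↦ LieSubmodule.Quotient.mk_bracket (center K L) x y }

theorem LieAlgebra.mkCenter_eq_zero {x : L} : mkCenter K L x = 0 ↔ x ∈ center K L :=
  LieSubmodule.Quotient.mk_eq_zero (N := center K L)

theorem LieAlgebra.mkCenter_surjective : Function.Surjective (mkCenter K L) :=
  LieSubmodule.Quotient.surjective_mk' (center K L)

theorem LieAlgebra.hasTrivialRadical_quotient_center_s4 [FiniteDimensional K L]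
    (h : radical K L = center K L) : HasTrivialRadical K (L ⧸ center K L) := by
  apply hasTrivialRadical_of_no_solvable_ideals
  intro I hI
  let π := mkCenter K L
  let J : LieIdeal K L := I.comap π
  obtain ⟨k, hk⟩ := IsSolvable.solvable K I
  rw [LieIdeal.derivedSeries_eq_bot_iff] at hk
  have hmap (m : ℕ) : ∀ x ∈ derivedSeriesOfIdeal K L m J, π x ∈ derivedSeriesOfIdeal K _ m I := by
    induction m with
    | zero => exact fun x hx ↦ hx
    | succ m ih =>
      intro x hx
      rw [derivedSeriesOfIdeal_succ] at hx ⊢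
      have : derivedSeriesOfIdeal K L m J ≤ (derivedSeriesOfIdeal K _ m I).comap π := ih
      exact LieIdeal.comap_bracket_le π (LieSubmodule.mono_lie this this hx)
  have hcenter : derivedSeriesOfIdeal K L k J ≤ center K L := fun x hx ↦ mkCenter_eq_zero.mp <| by
    have := hmap k x hx
    rwa [hk, LieSubmodule.mem_bot] at this
  have hJ : IsSolvable J := by
    refine IsSolvable.mk (k := k + 1) ((LieIdeal.derivedSeries_eq_bot_iff J (k + 1)).mpr ?_)
    rw [derivedSeriesOfIdeal_succ, eq_bot_iff, LieSubmodule.lie_le_iff]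
    intro x hx m hm
    rw [LieSubmodule.mem_bot]
    exact (mem_maxTrivSubmodule K L L m).mp (hcenter hm) x
  have hJr : J ≤ center K L := h ▸ (LieIdeal.solvable_iff_le_radical K L J).mp hJ
  rw [LieSubmodule.eq_bot_iff]
  intro y hy
  obtain ⟨x, rfl⟩ := mkCenter_surjective y
  exact mkCenter_eq_zero.mpr (hJr hy)

theorem LieAlgebra.center_sup_lie_top_top [CharZero K] [FiniteDimensional K L]
    (h : radical K L = center K L) :
    center K L ⊔ ⁅(⊤ : LieIdeal K L), (⊤ : LieIdeal K L)⁆ = ⊤ := by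
  have := hasTrivialRadical_quotient_center_s4 h
  have hmap : (⊤ : LieIdeal K (L ⧸ center K L)).toSubmodule ≤
      (⁅(⊤ : LieIdeal K L), (⊤ : LieIdeal K L)⁆ : LieIdeal K L).toSubmodule.map
        (mkCenter K L : L →ₗ[K] L ⧸ center K L) := by
    rw [← lie_top_top_eq_top, LieSubmodule.lieIdeal_oper_eq_linear_span', Submodule.span_le]
    rintro _ ⟨q, _, r, _, rfl⟩
    obtain ⟨x, rfl⟩ := mkCenter_surjective q
    obtain ⟨y, rfl⟩ := mkCenter_surjective r
    exact ⟨⁅x, y⁆, LieSubmodule.lie_mem_lie (LieSubmodule.mem_top x) (LieSubmodule.mem_top y),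
      LieHom.map_lie _ x y⟩
  rw [eq_top_iff]
  intro x _
  obtain ⟨y, hy, hyx⟩ := hmap (LieSubmodule.mem_top (mkCenter K L x))
  replace hyx : mkCenter K L y = mkCenter K L x := hyx
  refine (LieSubmodule.mem_sup _ _ _).mpr ⟨x - y, ?_, y, hy, sub_add_cancel x y⟩
  rw [← mkCenter_eq_zero, map_sub, hyx, sub_self]

variable [AddCommGroup N] [Module K N] [LieRingModule L N] [LieModule K L N]

/-- The equivariant endomorphism given by the action of a central element. -/
def LieModule.centerHom (z : LieAlgebra.center K L) : N →ₗ⁅K, L⁆ N :=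
  { toEnd K L N z with
    map_lie' := fun {x n} ↦ by
      have : ⁅x, (z : L)⁆ = 0 := (mem_maxTrivSubmodule K L L z).mp z.2 x
      change ⁅(z : L), ⁅x, n⁆⁆ = ⁅x, ⁅(z : L), n⁆⁆
      rw [leibniz_lie x, this, zero_lie, zero_add] }

theorem LieModule.exists_eq_centerHom_add
    (hss : ∀ W : LieSubmodule K L N, ∃ W', IsCompl W W') {z : L}
    (hz : z ∈ LieAlgebra.center K L) (n : N) : ∃ m w : N, n = ⁅z, m⁆ + w ∧ ⁅z, w⁆ = 0 := by
  let T : N →ₗ⁅K, L⁆ N := centerHom ⟨z, hz⟩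
  obtain ⟨W, hW⟩ := hss T.range
  have hn : n ∈ T.range ⊔ W := hW.sup_eq_top ▸ LieSubmodule.mem_top n
  obtain ⟨r, hr, w, hw, rfl⟩ := (LieSubmodule.mem_sup _ _ _).mp hn
  obtain ⟨m, rfl⟩ := (LieModuleHom.mem_range T _).mp hr
  refine ⟨m, w, rfl, ?_⟩
  have : ⁅z, w⁆ ∈ T.range ⊓ W := ⟨(LieModuleHom.mem_range T _).mpr ⟨w, rfl⟩, W.lie_mem hw⟩
  rwa [hW.inf_eq_bot, LieSubmodule.mem_bot] at this

/-- The action of the quotient by the center on a module on which the center acts trivially. -/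
def LieModule.quotientCenterAction
    (hz : ∀ z ∈ LieAlgebra.center K L, ∀ n : N, ⁅z, n⁆ = 0) :
    (L ⧸ LieAlgebra.center K L) →ₗ[K] N →ₗ[K] N :=
  Submodule.liftQ (LieAlgebra.center K L).toSubmodule (toEnd K L N : L →ₗ[K] Module.End K N)
    fun z hzc ↦ LinearMap.ext fun n ↦ hz z hzc n

theorem LieModule.isIrreducible_of_isAtom {A : LieSubmodule K L N} (hA : IsAtom A) :
    IsIrreducible K L A := by
  have : Nontrivial A := (LieSubmodule.nontrivial_iff_ne_bot K L N).mpr hA.1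
  refine IsIrreducible.mk fun W hW ↦ ?_
  have hle : W.map A.incl ≤ A := by
    rintro _ ⟨w, _, rfl⟩
    exact w.2
  rcases hA.le_iff.mp hle with h | h
  · refine absurd ?_ hW
    rw [LieSubmodule.eq_bot_iff] at h ⊢
    exact fun w hw ↦ Subtype.ext (h w ⟨w, hw, rfl⟩)
  · rw [eq_top_iff]
    intro a _
    obtain ⟨w, hw, hwa⟩ := h.ge a.2
    rwa [← Subtype.ext hwa]

theorem LieModule.projectionOnto_lie {A A' : LieSubmodule K L N}
    (hc : IsCompl A.toSubmodule A'.toSubmodule) (x : L) (n : N) :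
    A.toSubmodule.projectionOnto A'.toSubmodule hc ⁅x, n⁆ =
      (⁅x, (A.toSubmodule.projectionOnto A'.toSubmodule hc n : A)⁆ : A) := by
  set p := A.toSubmodule.projectionOnto A'.toSubmodule hc with hp
  have h1 : n - p n ∈ A'.toSubmodule := by
    rw [← Submodule.projectionOnto_apply_eq_zero_iff hc, map_sub,
      Submodule.projectionOnto_apply_left, sub_self]
  have h2 : p ⁅x, n - (p n : N)⁆ = 0 :=
    (Submodule.projectionOnto_apply_eq_zero_iff hc).mpr (A'.lie_mem h1)
  have h3 : p ⁅x, (p n : N)⁆ = (⁅x, (p n : A)⁆ : A) :=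
    Submodule.projectionOnto_apply_left hc (⁅x, (p n : A)⁆ : A)
  rw [← h3, ← sub_eq_zero, ← map_sub, ← lie_sub, h2]

variable [CharZero K] [FiniteDimensional K L] [FiniteDimensional K N]

theorem LieModule.exists_eq_lie_of_center_trivial
    (h : LieAlgebra.radical K L = LieAlgebra.center K L) [IsIrreducible K L N]
    (hN : ¬ IsTrivial L N) (hz : ∀ z ∈ LieAlgebra.center K L, ∀ n : N, ⁅z, n⁆ = 0)
    (f : L →ₗ[K] N) (hf : ∀ x y, f ⁅x, y⁆ = ⁅x, f y⁆ - ⁅y, f x⁆) :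
    ∃ u : N, ∀ x, f x = ⁅x, u⁆ := by
  have := LieAlgebra.hasTrivialRadical_quotient_center_s4 h
  have hfz (z : L) (hzc : z ∈ LieAlgebra.center K L) : f z = 0 := by
    have hmem : f z ∈ maxTrivSubmodule K L N := (mem_maxTrivSubmodule K L N _).mpr fun x ↦ by
      have := hf x z
      rw [hz z hzc, sub_zero, (mem_maxTrivSubmodule K L L z).mp hzc x, map_zero] at this
      exact this.symm
    have hbot : maxTrivSubmodule K L N = ⊥ := (eq_bot_or_eq_top _).resolve_right fun htop ↦
      hN ((isTrivial_iff_max_triv_eq_top K L N).mpr htop)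
    rwa [hbot, LieSubmodule.mem_bot] at hmem
  let Q := L ⧸ LieAlgebra.center K L
  let mk : L → Q := LieSubmodule.Quotient.mk
  have hmk : Function.Surjective mk := LieAlgebra.mkCenter_surjective
  have hlie (x y : L) : ⁅mk x, mk y⁆ = mk ⁅x, y⁆ :=
    (LieSubmodule.Quotient.mk_bracket (LieAlgebra.center K L) x y).symm
  let A : Q →ₗ[K] N →ₗ[K] N := quotientCenterAction hz
  have hA (x : L) (n : N) : A (mk x) n = ⁅x, n⁆ := rfl
  let _ : LieRingModule Q N :=
    { bracket := fun q n ↦ A q n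
      add_lie := fun q r n ↦ by change A (q + r) n = A q n + A r n; simp
      lie_add := fun q n m ↦ (A q).map_add n m
      leibniz_lie := fun q r n ↦ by
        obtain ⟨x, rfl⟩ := hmk q
        obtain ⟨y, rfl⟩ := hmk r
        change A (mk x) (A (mk y) n) = A ⁅mk x, mk y⁆ n + A (mk y) (A (mk x) n)
        rw [hlie, hA, hA, hA, hA, hA]
        exact leibniz_lie x y n }
  have hact (x : L) (n : N) : ⁅mk x, n⁆ = ⁅x, n⁆ := rfl
  let _ : LieModule K Q N :=
    { smul_lie := fun c q n ↦ by change A (c • q) n = c • A q n; simp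
      lie_smul := fun c q n ↦ (A q).map_smul c n }
  have := nontrivial_of_isIrreducible K L N
  have : IsIrreducible K Q N := by
    refine IsIrreducible.mk fun W hW ↦ ?_
    let W' : LieSubmodule K L N :=
      { W.toSubmodule with lie_mem := fun {x n} hn ↦ W.lie_mem (x := mk x) hn }
    have : W' = ⊤ := (eq_bot_or_eq_top W').resolve_left fun hbot ↦ hW <| by
      rw [LieSubmodule.eq_bot_iff] at hbot ⊢
      exact hbot
    rw [eq_top_iff]
    intro n _
    have hn : n ∈ W' := this ▸ LieSubmodule.mem_top n
    exact hn
  have hNQ : ¬ IsTrivial Q N := fun htriv ↦ hN ⟨fun x n ↦ htriv.trivial (mk x) n⟩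
  let g : Q →ₗ[K] N := Submodule.liftQ (LieAlgebra.center K L).toSubmodule f hfz
  have hg (x : L) : g (mk x) = f x := rfl
  obtain ⟨u, hu⟩ := exists_eq_lie_of_isIrreducible hNQ g fun q r ↦ by
    obtain ⟨x, rfl⟩ := hmk q
    obtain ⟨y, rfl⟩ := hmk r
    rw [hlie, hg, hg, hg, hact, hact, hf]
  exact ⟨u, fun x ↦ hu (mk x)⟩

theorem LieModule.exists_add_lie_mem_maxTriv_of_isIrreducible
    (h : LieAlgebra.radical K L = LieAlgebra.center K L) [IsIrreducible K L N]
    (f : L →ₗ[K] N) (hf : ∀ x y, f ⁅x, y⁆ = ⁅x, f y⁆ - ⁅y, f x⁆) :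
    ∃ u : N, ∀ x, f x + ⁅x, u⁆ ∈ maxTrivSubmodule K L N := by
  by_cases hN : IsTrivial L N
  · exact ⟨0, fun x ↦ (mem_maxTrivSubmodule K L N _).mpr fun y ↦ trivial_lie_zero L N y _⟩
  by_cases hz : ∀ z ∈ LieAlgebra.center K L, ∀ n : N, ⁅z, n⁆ = 0
  · obtain ⟨u, hu⟩ := exists_eq_lie_of_center_trivial h hN hz f hf
    refine ⟨-u, fun x ↦ ?_⟩
    rw [hu, lie_neg, add_neg_cancel]
    exact zero_mem _
  push Not at hz
  obtain ⟨z, hzc, n, hn⟩ := hz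
  let T : N →ₗ⁅K, L⁆ N := centerHom ⟨z, hzc⟩
  have hT (m : N) : T m = ⁅z, m⁆ := rfl
  have hker : T.ker = ⊥ := (eq_bot_or_eq_top T.ker).resolve_right fun htop ↦ hn <| by
    have : n ∈ T.ker := htop ▸ LieSubmodule.mem_top n
    exact this
  have hinj : Function.Injective (T : N →ₗ[K] N) := (LieModuleHom.ker_eq_bot T).mp hker
  obtain ⟨u, hu⟩ := LinearMap.injective_iff_surjective.mp hinj (-f z)
  replace hu : T u = -f z := hu
  refine ⟨u, fun x ↦ ?_⟩
  have : f x + ⁅x, u⁆ = 0 := by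
    apply hinj
    change T (f x + ⁅x, u⁆) = T 0
    rw [map_add, map_zero, LieModuleHom.map_lie, hu, hT, lie_neg, ← sub_eq_add_neg, ← hf,
      ← lie_skew, (mem_maxTrivSubmodule K L L z).mp hzc x, neg_zero, map_zero]
  rw [this]
  exact zero_mem _

theorem LieModule.exists_add_lie_mem_maxTriv
    (h : LieAlgebra.radical K L = LieAlgebra.center K L)
    (hss : ∀ W : LieSubmodule K L N, ∃ W', IsCompl W W')
    (f : L →ₗ[K] N) (hf : ∀ x y, f ⁅x, y⁆ = ⁅x, f y⁆ - ⁅y, f x⁆) :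
    ∃ u : N, ∀ x, f x + ⁅x, u⁆ ∈ maxTrivSubmodule K L N := by
  suffices H : ∀ (W : LieSubmodule K L N) (f : L →ₗ[K] N), (∀ x, f x ∈ W) →
      (∀ x y, f ⁅x, y⁆ = ⁅x, f y⁆ - ⁅y, f x⁆) →
      ∃ u : N, ∀ x, f x + ⁅x, u⁆ ∈ maxTrivSubmodule K L N from
    H ⊤ f (fun x ↦ LieSubmodule.mem_top _) hf
  have := LieSubmodule.wellFoundedLT_of_isArtinian K L N
  intro W
  induction W using WellFoundedLT.induction with
  | ind W ih =>
  intro f hfW hf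
  rcases eq_bot_or_exists_atom_le W with rfl | ⟨A, hA, hAW⟩
  · refine ⟨0, fun x ↦ ?_⟩
    rw [(LieSubmodule.mem_bot _).mp (hfW x), lie_zero, add_zero]
    exact zero_mem _
  obtain ⟨A', hAA'⟩ := hss A
  have hc : IsCompl A.toSubmodule A'.toSubmodule := LieSubmodule.isCompl_toSubmodule.mpr hAA'
  have := isIrreducible_of_isAtom hA
  let p : N →ₗ[K] A := A.toSubmodule.projectionOnto A'.toSubmodule hc
  have hp (x : L) (n : N) : p ⁅x, n⁆ = ⁅x, p n⁆ := projectionOnto_lie hc x n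
  have hpc (x : L) (n : N) : ((p ⁅x, n⁆ : A) : N) = ⁅x, ((p n : A) : N)⁆ := by rw [hp]; rfl
  obtain ⟨u₁, hu₁⟩ := exists_add_lie_mem_maxTriv_of_isIrreducible h (p.comp f) fun x y ↦ by
    simp [hf, hp]
  let f₂ : L →ₗ[K] N := f - A.toSubmodule.subtype.comp (p.comp f)
  have hf₂ (x : L) : f₂ x = f x - (p (f x) : N) := rfl
  have hlt : W ⊓ A' < W := by
    refine inf_le_left.lt_of_ne fun heq ↦ hA.1 ?_
    rw [eq_bot_iff, ← hAA'.inf_eq_bot]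
    exact le_inf le_rfl (hAW.trans (inf_eq_left.mp heq))
  obtain ⟨u₂, hu₂⟩ := ih (W ⊓ A') hlt f₂
    (fun x ↦ ⟨sub_mem (hfW x) (hAW (p (f x)).2), by
      change f x - (p (f x) : N) ∈ A'.toSubmodule
      rw [← Submodule.projectionOnto_apply_eq_zero_iff hc, map_sub,
        Submodule.projectionOnto_apply_left, sub_self]⟩)
    (fun x y ↦ by
      simp only [hf₂, hf, map_sub, hp, lie_sub, LieSubmodule.coe_sub, LieSubmodule.coe_bracket]
      abel)
  refine ⟨u₁ + u₂, fun x ↦ (mem_maxTrivSubmodule K L N _).mpr fun y ↦ ?_⟩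
  have e₁ : ⁅y, (p (f x) : N) + ⁅x, (u₁ : N)⁆⁆ = 0 :=
    congrArg Subtype.val ((mem_maxTrivSubmodule K L A _).mp (hu₁ x) y)
  have e₂ := (mem_maxTrivSubmodule K L N _).mp (hu₂ x) y
  have : f x + ⁅x, (u₁ : N) + u₂⁆ = (p (f x) : N) + ⁅x, (u₁ : N)⁆ + (f₂ x + ⁅x, u₂⁆) := by
    rw [hf₂, lie_add]
    abel
  rw [this, lie_add, e₁, e₂, add_zero]

end Reductive


/- STATEMENT 4: every odd derivation of a quasireductive finite-dimensional Lie superalgebra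
becomes g₀-invariant after subtracting an inner odd derivation attached to some u ∈ g₁. -/

variable {F : Type} [Field F] [IsAlgClosed F] [CharZero F]
variable {g0 : Type} [LieRing g0] [LieAlgebra F g0] [FiniteDimensional F g0]
variable {g1 : Type} [AddCommGroup g1] [Module F g1] [FiniteDimensional F g1]
variable [LieRingModule g0 g1] [LieModule F g0 g1]

theorem stmt4
    (br : g1 →ₗ[F] g1 →ₗ[F] g0)
    (hsymm : ∀ v w : g1, br v w = br w v)
    (hequiv : ∀ (a : g0) (v w : g1), ⁅a, br v w⁆ = br ⁅a, v⁆ w + br v ⁅a, w⁆)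
    (hjac : ∀ u v w : g1, ⁅br u v, w⁆ + ⁅br v w, u⁆ + ⁅br w u, v⁆ = 0)
    (hred : LieAlgebra.radical F g0 = LieAlgebra.center F g0)
    (hss : ∀ N : LieSubmodule F g0 g1, ∃ N', IsCompl N N')
    (E : g0 →ₗ[F] g1) (Fm : g1 →ₗ[F] g0)
    (hE : ∀ a b : g0, E ⁅a, b⁆ = ⁅a, E b⁆ - ⁅b, E a⁆)
    (hF : ∀ (a : g0) (v : g1), Fm ⁅a, v⁆ = br (E a) v + ⁅a, Fm v⁆)
    (hEbr : ∀ v w : g1, E (br v w) = ⁅Fm v, w⁆ + ⁅Fm w, v⁆) :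
    ∃ u : g1,
      (∀ a b : g0, E ⁅a, b⁆ + ⁅⁅a, b⁆, u⁆ = ⁅a, E b + ⁅b, u⁆⁆) ∧
      (∀ (a : g0) (v : g1), Fm ⁅a, v⁆ - br u ⁅a, v⁆ = ⁅a, Fm v - br u v⁆) := by
  obtain ⟨u, hu⟩ := LieModule.exists_add_lie_mem_maxTriv hred hss E hE
  have hinv (a b : g0) : ⁅b, E a + ⁅a, u⁆⁆ = 0 := (LieModule.mem_maxTrivSubmodule F g0 g1 _).mp (hu a) b
  have hbr (a b : g0) : E ⁅a, b⁆ + ⁅⁅a, b⁆, u⁆ = 0 := by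
    have h1 := hinv b a
    have h2 := hinv a b
    rw [lie_add] at h1 h2
    rw [hE, lie_lie, ← sub_eq_zero.mpr (h1.trans h2.symm)]
    abel
  let E' : g0 →ₗ[F] g1 := E + (LieModule.toEnd F g0 g1 : g0 →ₗ[F] Module.End F g1).flip u
  have hE' (a : g0) : E' a = E a + ⁅a, u⁆ := rfl
  have hF' (a : g0) (v : g1) :
      Fm ⁅a, v⁆ - br u ⁅a, v⁆ = br (E' a) v + ⁅a, Fm v - br u v⁆ := by
    rw [hF, lie_sub, hequiv, hE', map_add, LinearMap.add_apply]
    abel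
  have hker : (⊤ : LieIdeal F g0).toSubmodule ≤ LinearMap.ker (br.comp E') := by
    rw [← LieAlgebra.center_sup_lie_top_top hred, LieSubmodule.sup_toSubmodule, sup_le_iff]
    constructor
    · intro z hz
      have hzz (x : g0) : ⁅z, x⁆ = 0 := by
        rw [← lie_skew, (LieModule.mem_maxTrivSubmodule F g0 g0 z).mp hz x, neg_zero]
      rw [LinearMap.mem_ker]
      ext v
      obtain ⟨m, w, rfl, hw⟩ := LieModule.exists_eq_centerHom_add hss hz v
      have h1 : br (E' z) ⁅z, m⁆ = 0 := by
        have := hequiv z (E' z) m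
        rw [hzz, hE', hinv, map_zero, LinearMap.zero_apply, zero_add] at this
        exact this.symm
      have h2 : br (E' z) w = 0 := by
        have := hF' z w
        rw [hw, hzz, map_zero, map_zero, sub_zero, add_zero] at this
        exact this.symm
      change br (E' z) (⁅z, m⁆ + w) = 0
      rw [map_add, h1, h2, add_zero]
    · rw [LieSubmodule.lieIdeal_oper_eq_linear_span', Submodule.span_le]
      rintro _ ⟨a, _, b, _, rfl⟩
      change br (E' ⁅a, b⁆) = 0
      rw [hE', hbr, map_zero]
  refine ⟨u, fun a b ↦ by rw [hbr, hinv], fun a v ↦ ?_⟩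
  have h0 : br (E' a) = 0 := hker (LieSubmodule.mem_top a)
  rw [hF', h0, LinearMap.zero_apply, zero_add]
end

section
/- Let k be a finite-dimensional simple Lie algebra over F and let k^d be the Lie superalgebra with g₀ = k, g₁ = k carrying the adjoint action, and ⟨·,·⟩ = 0. Then: (a) every even derivation of k^d is of the form (ad x, v ↦ [x, v] + t v) for a unique x ∈ k and a unique t ∈ F; (b) every odd derivation of k^d is of the form (a ↦ [u, a], v ↦ s v) for a unique u ∈ k and a unique s ∈ F. In particular the space of even outer derivations and the space of odd outer derivations of k^d are each one-dimensional (Der(k^d)/ad(k^d) ≅ W(0|1)). -/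
/- STATEMENT 7: derivations of k^d (g₀ = k, g₁ = k adjoint, ⟨·,·⟩ = 0) for a simple Lie
algebra k: (a) every even derivation is (ad x, v ↦ [x,v] + t v) for unique (x, t);
(b) every odd derivation is (a ↦ [u,a], v ↦ s v) for unique (u, s). -/

variable {F : Type} [Field F] [IsAlgClosed F] [CharZero F]
variable {k : Type} [LieRing k] [LieAlgebra F k] [FiniteDimensional F k]
variable [LieAlgebra.IsSimple F k]

/-- Schur's lemma for the adjoint representation of a simple Lie algebra. -/
lemma LieAlgebra.IsSimple.exists_eq_smul_of_map_lie
    {K L : Type*} [Field K] [IsAlgClosed K] [LieRing L] [LieAlgebra K L]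
    [FiniteDimensional K L] [LieAlgebra.IsSimple K L]
    (T : L →ₗ[K] L)
    (hT : ∀ a v : L, T ⁅a, v⁆ = ⁅a, T v⁆) : ∃ t : K, ∀ v : L, T v = t • v := by
  have : Nontrivial L := by
    by_contra h
    rw [not_nontrivial_iff_subsingleton] at h
    exact LieAlgebra.IsSimple.non_abelian (R := K) (L := L) ⟨fun _ _ ↦ Subsingleton.elim _ _⟩
  obtain ⟨t, ht⟩ := Module.End.exists_eigenvalue T
  let I : LieIdeal K L :=
    { Module.End.eigenspace T t with
      lie_mem := by
        intro x m hm
        have hm' : T m = t • m := Module.End.mem_eigenspace_iff.mp hm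
        exact Module.End.mem_eigenspace_iff.mpr (by rw [hT, hm', lie_smul]) }
  refine ⟨t, fun v ↦ ?_⟩
  rcases LieAlgebra.IsSimple.eq_bot_or_eq_top I with h | h
  · exact absurd (congrArg LieSubmodule.toSubmodule h) ht
  · have hv : v ∈ I := h ▸ LieSubmodule.mem_top v
    exact Module.End.mem_eigenspace_iff.mp hv

/-- Every derivation of a simple Lie algebra in characteristic zero is inner. -/
lemma LieAlgebra.IsSimple.exists_eq_lie_of_leibniz
    {K L : Type*} [Field K] [CharZero K] [LieRing L] [LieAlgebra K L]
    [FiniteDimensional K L] [LieAlgebra.IsSimple K L]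
    (D : L →ₗ[K] L)
    (hD : ∀ a b : L, D ⁅a, b⁆ = ⁅D a, b⁆ + ⁅a, D b⁆) : ∃ x : L, ∀ a : L, D a = ⁅x, a⁆ := by
  let D' : LieDerivation K L L :=
    ⟨D, fun a b ↦ by rw [hD, ← lie_skew (D a) b]; abel⟩
  obtain ⟨x, hx⟩ := LieDerivation.IsKilling.exists_eq_ad D'
  exact ⟨x, fun a ↦ (DFunLike.congr_fun hx a).symm.trans (LieDerivation.ad_apply_apply K L x a)⟩

lemma LieAlgebra.IsSimple.eq_of_lie_eq
    (K : Type*) {L : Type*} [Field K] [CharZero K] [LieRing L] [LieAlgebra K L]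
    [FiniteDimensional K L] [LieAlgebra.IsSimple K L]
    {x y : L} (h : ∀ a : L, ⁅x, a⁆ = ⁅y, a⁆) : x = y := by
  rw [← sub_eq_zero, ← LieDerivation.IsKilling.ad_apply_eq_zero_iff K L]
  ext a
  simp [h a]

lemma LieAlgebra.IsSimple.eq_of_smul_eq
    {K L : Type*} [Field K] [LieRing L] [LieAlgebra K L]
    [LieAlgebra.IsSimple K L]
    {s t : K} (h : ∀ v : L, s • v = t • v) : s = t := by
  by_contra hst
  refine LieAlgebra.IsSimple.non_abelian (R := K) (L := L) ⟨fun x y ↦ ?_⟩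
  have := h ⁅x, y⁆
  rw [← sub_eq_zero, ← sub_smul] at this
  exact (smul_eq_zero.mp this).resolve_left (sub_ne_zero.mpr hst)

theorem stmt7 :
    -- (a) even derivations of k^d
    (∀ D0 D1 : k →ₗ[F] k,
      (∀ a b : k, D0 ⁅a, b⁆ = ⁅D0 a, b⁆ + ⁅a, D0 b⁆) →
      (∀ (a : k) (v : k), D1 ⁅a, v⁆ = ⁅D0 a, v⁆ + ⁅a, D1 v⁆) →
      ∃! p : k × F, (∀ a : k, D0 a = ⁅p.1, a⁆) ∧ (∀ v : k, D1 v = ⁅p.1, v⁆ + p.2 • v)) ∧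
    -- (b) odd derivations of k^d
    (∀ E Fm : k →ₗ[F] k,
      (∀ a b : k, E ⁅a, b⁆ = ⁅a, E b⁆ - ⁅b, E a⁆) →
      (∀ (a : k) (v : k), Fm ⁅a, v⁆ = ⁅a, Fm v⁆) →
      (∀ v w : k, (0 : k) = ⁅Fm v, w⁆ + ⁅Fm w, v⁆) →
      ∃! p : k × F, (∀ a : k, E a = ⁅p.1, a⁆) ∧ (∀ v : k, Fm v = p.2 • v)) := by
  refine ⟨fun D0 D1 h0 h1 ↦ ?_, fun E Fm hE hF _ ↦ ?_⟩
  · obtain ⟨x, hx⟩ := LieAlgebra.IsSimple.exists_eq_lie_of_leibniz D0 h0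
    obtain ⟨t, ht⟩ := LieAlgebra.IsSimple.exists_eq_smul_of_map_lie (D1 - LieAlgebra.ad F k x)
      (fun a v ↦ by
        simp only [LinearMap.sub_apply, LieAlgebra.ad_apply, h1, hx, lie_sub, leibniz_lie x a v]
        abel)
    have hD1 : ∀ v : k, D1 v = ⁅x, v⁆ + t • v := fun v ↦ by
      rw [← ht v, LinearMap.sub_apply, LieAlgebra.ad_apply, add_sub_cancel]
    refine ⟨(x, t), ⟨hx, hD1⟩, ?_⟩
    rintro ⟨y, s⟩ ⟨hy, hs⟩
    obtain rfl : y = x :=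
      LieAlgebra.IsSimple.eq_of_lie_eq F fun a ↦ (hy a).symm.trans (hx a)
    exact Prod.ext rfl <| LieAlgebra.IsSimple.eq_of_smul_eq (L := k) fun v ↦
      add_left_cancel ((hs v).symm.trans (hD1 v))
  · obtain ⟨u, hu⟩ := LieAlgebra.IsSimple.exists_eq_lie_of_leibniz E
      (fun a b ↦ by rw [hE, ← lie_skew (E a) b]; abel)
    obtain ⟨s, hs⟩ := LieAlgebra.IsSimple.exists_eq_smul_of_map_lie Fm hF
    refine ⟨(u, s), ⟨hu, hs⟩, ?_⟩
    rintro ⟨y, r⟩ ⟨hy, hr⟩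
    exact Prod.ext
      (LieAlgebra.IsSimple.eq_of_lie_eq F fun a ↦ (hy a).symm.trans (hu a))
      (LieAlgebra.IsSimple.eq_of_smul_eq (L := k) fun v ↦ (hr v).symm.trans (hs v))
end

section
/- Let g be a quasireductive finite-dimensional Lie superalgebra over F with Z(g)₀ = 0 and Z(g)₁ = 0. Then the centralizer of C(g) in g is contained in C(g); explicitly: (a) if x ∈ g₀ satisfies [x, C(g)₀] = 0 and x • C(g)₁ = 0, then x = 0; (b) if v ∈ g₁ satisfies C(g)₀ • v = 0 and ⟨v, C(g)₁⟩ = 0, then v ∈ C(g)₁. -/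
/- STATEMENT 8: if g is quasireductive with Z(g) = 0, then the centralizer of C(g)
(the sum of all minimal ideals) in g is contained in C(g). -/

variable {F : Type} [Field F] [IsAlgClosed F] [CharZero F]
variable {g0 : Type} [LieRing g0] [LieAlgebra F g0] [FiniteDimensional F g0]
variable {g1 : Type} [AddCommGroup g1] [Module F g1] [FiniteDimensional F g1]
variable [LieRingModule g0 g1] [LieModule F g0 g1]

/-- The even part of C(g), the sum of all minimal ideals of g. -/
noncomputable def CEven (br : g1 →ₗ[F] g1 →ₗ[F] g0) : Submodule F g0 :=
  sSup {m0 : Submodule F g0 | ∃ m1 : Submodule F g1, IsMinimalIdeal br m0 m1}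

/-- The odd part of C(g), the sum of all minimal ideals of g. -/
noncomputable def COdd (br : g1 →ₗ[F] g1 →ₗ[F] g0) : Submodule F g1 :=
  sSup {m1 : Submodule F g1 | ∃ m0 : Submodule F g0, IsMinimalIdeal br m0 m1}

/-- Every nonzero ideal contains a minimal ideal. -/
theorem IsIdeal.exists_isMinimalIdeal_le {br : g1 →ₗ[F] g1 →ₗ[F] g0}
    {l0 : Submodule F g0} {l1 : Submodule F g1} (hl : IsIdeal br l0 l1)
    (hne : l0 ≠ ⊥ ∨ l1 ≠ ⊥) :
    ∃ m0 m1, IsMinimalIdeal br m0 m1 ∧ m0 ≤ l0 ∧ m1 ≤ l1 := by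
  let P : Submodule F g0 × Submodule F g1 → Prop :=
    fun p => IsIdeal br p.1 p.2 ∧ (p.1 ≠ ⊥ ∨ p.2 ≠ ⊥) ∧ p.1 ≤ l0 ∧ p.2 ≤ l1
  obtain ⟨m, hm, hmin⟩ := WellFounded.has_min
    (wellFounded_lt : WellFounded
      ((· < ·) : Submodule F g0 × Submodule F g1 → _ → Prop)) {p | P p}
    ⟨(l0, l1), hl, hne, le_rfl, le_rfl⟩
  obtain ⟨hmI, hmne, hm0, hm1⟩ := hm
  refine ⟨m.1, m.2, ⟨hmI, hmne, fun n0 n1 hn h0 h1 hnne => ?_⟩, hm0, hm1⟩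
  by_contra hcon
  refine hmin (n0, n1) ⟨hn, hnne, h0.trans hm0, h1.trans hm1⟩
    (lt_of_le_of_ne ⟨h0, h1⟩ fun h => hcon ?_)
  exact ⟨congrArg Prod.fst h, congrArg Prod.snd h⟩

theorem IsMinimalIdeal.le_CEven {br : g1 →ₗ[F] g1 →ₗ[F] g0}
    {m0 : Submodule F g0} {m1 : Submodule F g1} (h : IsMinimalIdeal br m0 m1) :
    m0 ≤ CEven br :=
  le_sSup ⟨m1, h⟩

theorem IsMinimalIdeal.le_COdd {br : g1 →ₗ[F] g1 →ₗ[F] g0}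
    {m0 : Submodule F g0} {m1 : Submodule F g1} (h : IsMinimalIdeal br m0 m1) :
    m1 ≤ COdd br :=
  le_sSup ⟨m0, h⟩

/-- The sum of all minimal ideals is an ideal. -/
theorem isIdeal_CEven_COdd (br : g1 →ₗ[F] g1 →ₗ[F] g0) :
    IsIdeal br (CEven br) (COdd br) := by
  refine ⟨fun a => ?_, fun a => ?_, fun x hx v => ?_, fun v hv w => ?_⟩
  · rintro x hx
    refine (sSup_le ?_ : CEven br ≤ (CEven br).comap (LieModule.toEnd F g0 g0 a)) hx
    rintro m0 ⟨m1, hm⟩ y hy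
    exact hm.le_CEven (hm.1.1 a y hy)
  · rintro v hv
    refine (sSup_le ?_ : COdd br ≤ (COdd br).comap (LieModule.toEnd F g0 g1 a)) hv
    rintro m1 ⟨m0, hm⟩ y hy
    exact hm.le_COdd (hm.1.2.1 a y hy)
  · refine (sSup_le ?_ : CEven br ≤
      (COdd br).comap ((LieModule.toEnd F g0 g1 : g0 →ₗ[F] Module.End F g1).flip v)) hx
    rintro m0 ⟨m1, hm⟩ y hy
    exact hm.le_COdd (hm.1.2.2.1 y hy v)
  · refine (sSup_le ?_ : COdd br ≤ (CEven br).comap (br.flip w)) hv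
    rintro m1 ⟨m0, hm⟩ y hy
    exact hm.le_CEven (hm.1.2.2.2 y hy w)

/-- The even part of the centralizer of `(c0, c1)`. -/
def centralizerEven (c0 : Submodule F g0) (c1 : Submodule F g1) : Submodule F g0 where
  carrier := {x | (∀ y ∈ c0, ⁅x, y⁆ = 0) ∧ ∀ v ∈ c1, ⁅x, v⁆ = 0}
  add_mem' hx hx' :=
    ⟨fun y hy => by rw [add_lie, hx.1 y hy, hx'.1 y hy, add_zero],
      fun v hv => by rw [add_lie, hx.2 v hv, hx'.2 v hv, add_zero]⟩
  zero_mem' := ⟨fun y _ => zero_lie y, fun v _ => zero_lie v⟩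
  smul_mem' t x hx :=
    ⟨fun y hy => by rw [smul_lie, hx.1 y hy, smul_zero],
      fun v hv => by rw [smul_lie, hx.2 v hv, smul_zero]⟩

/-- The odd part of the centralizer of `(c0, c1)`. -/
def centralizerOdd (br : g1 →ₗ[F] g1 →ₗ[F] g0)
    (c0 : Submodule F g0) (c1 : Submodule F g1) : Submodule F g1 where
  carrier := {v | (∀ y ∈ c0, ⁅y, v⁆ = 0) ∧ ∀ w ∈ c1, br v w = 0}
  add_mem' hx hx' :=
    ⟨fun y hy => by rw [lie_add, hx.1 y hy, hx'.1 y hy, add_zero],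
      fun v hv => by rw [map_add, LinearMap.add_apply, hx.2 v hv, hx'.2 v hv, add_zero]⟩
  zero_mem' := ⟨fun y _ => lie_zero y, fun v _ => by rw [map_zero, LinearMap.zero_apply]⟩
  smul_mem' t x hx :=
    ⟨fun y hy => by rw [lie_smul, hx.1 y hy, smul_zero],
      fun v hv => by rw [map_smul, LinearMap.smul_apply, hx.2 v hv, smul_zero]⟩

/-- The centralizer of an ideal is an ideal. -/
theorem IsIdeal.centralizer {br : g1 →ₗ[F] g1 →ₗ[F] g0}
    (hsymm : ∀ v w : g1, br v w = br w v)
    (hequiv : ∀ (a : g0) (v w : g1), ⁅a, br v w⁆ = br ⁅a, v⁆ w + br v ⁅a, w⁆)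
    (hjac : ∀ u v w : g1, ⁅br u v, w⁆ + ⁅br v w, u⁆ + ⁅br w u, v⁆ = 0)
    {c0 : Submodule F g0} {c1 : Submodule F g1} (hc : IsIdeal br c0 c1) :
    IsIdeal br (centralizerEven c0 c1) (centralizerOdd br c0 c1) := by
  obtain ⟨h00, h01, h10, h11⟩ := hc
  refine ⟨fun a x hx => ⟨fun y hy => ?_, fun v hv => ?_⟩,
    fun a v hv => ⟨fun y hy => ?_, fun w hw => ?_⟩,
    fun x hx v => ⟨fun y hy => ?_, fun w hw => ?_⟩,
    fun v hv w => ⟨fun y hy => ?_, fun u hu => ?_⟩⟩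
  · rw [lie_lie, hx.1 y hy, hx.1 _ (h00 a y hy), lie_zero, sub_zero]
  · rw [lie_lie, hx.2 v hv, hx.2 _ (h01 a v hv), lie_zero, sub_zero]
  · have hya : ⁅y, a⁆ ∈ c0 := by
      rw [← lie_skew]
      exact c0.neg_mem (h00 a y hy)
    rw [leibniz_lie, hv.1 _ hya, hv.1 y hy, lie_zero, add_zero]
  · have h := hequiv a v w
    rw [hv.2 w hw, hv.2 _ (h01 a w hw), lie_zero, add_zero] at h
    exact h.symm
  · rw [leibniz_lie, ← lie_skew, hx.1 y hy, neg_zero, zero_lie, zero_add,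
      hx.2 _ (h10 y hy v)]
  · have h := hequiv x v w
    have hvw : br v w ∈ c0 := hsymm w v ▸ h11 w hw v
    rw [hx.2 w hw, hx.1 _ hvw, map_zero, add_zero] at h
    exact h.symm
  · rw [← lie_skew, hequiv, hv.1 y hy, hv.2 _ (h10 y hy w), map_zero,
      LinearMap.zero_apply, add_zero, neg_zero]
  · have h := hjac v w u
    have hwu : br w u ∈ c0 := hsymm u w ▸ h11 u hu w
    rw [hv.1 _ hwu, hsymm u v, hv.2 u hu, zero_lie, add_zero, add_zero] at h
    exact h

/-- The Lie submodule of odd elements which bracket trivially with all odd elements. -/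
def oddRadical (br : g1 →ₗ[F] g1 →ₗ[F] g0)
    (hequiv : ∀ (a : g0) (v w : g1), ⁅a, br v w⁆ = br ⁅a, v⁆ w + br v ⁅a, w⁆) :
    LieSubmodule F g0 g1 where
  __ := LinearMap.ker br
  lie_mem {a v} hv := by
    have hv' : br v = 0 := hv
    refine LinearMap.ext fun w => ?_
    have h := hequiv a v w
    rw [hv', LinearMap.zero_apply, LinearMap.zero_apply, lie_zero, add_zero] at h
    exact h.symm

theorem LieSubmodule.exists_add_of_isCompl {N N' : LieSubmodule F g0 g1} (h : IsCompl N N')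
    (v : g1) : ∃ n ∈ N, ∃ n' ∈ N', n + n' = v := by
  have hv : v ∈ N ⊔ N' := h.sup_eq_top ▸ LieSubmodule.mem_top v
  exact (LieSubmodule.mem_sup N N' v).1 hv

theorem LieSubmodule.eq_zero_of_disjoint {N N' : LieSubmodule F g0 g1} (h : Disjoint N N')
    {v : g1} (hv : v ∈ N) (hv' : v ∈ N') : v = 0 := by
  have : v ∈ N ⊓ N' := ⟨hv, hv'⟩
  rwa [h.eq_bot, LieSubmodule.mem_bot] at this

/-- Odd elements which bracket trivially with all odd elements lie in the sum of all
minimal ideals. -/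
theorem oddRadical_le_COdd {br : g1 →ₗ[F] g1 →ₗ[F] g0}
    (hequiv : ∀ (a : g0) (v w : g1), ⁅a, br v w⁆ = br ⁅a, v⁆ w + br v ⁅a, w⁆)
    (hss : ∀ N : LieSubmodule F g0 g1, ∃ N', IsCompl N N') {v : g1} (hv : br v = 0) :
    v ∈ COdd br := by
  let S : LieSubmodule F g0 g1 :=
    { COdd br with lie_mem := fun {a v} h => (isIdeal_CEven_COdd br).2.1 a v h }
  let R := oddRadical br hequiv
  obtain ⟨T, hT⟩ := hss (S ⊓ R)
  have hTR : (T ⊓ R).toSubmodule = ⊥ := by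
    by_contra hne
    have hI : IsIdeal br ⊥ (T ⊓ R).toSubmodule := by
      refine ⟨?_, fun a v hv => (T ⊓ R).lie_mem hv, ?_, ?_⟩
      · rintro a x hx
        rw [(Submodule.mem_bot F).1 hx, lie_zero]
        exact Submodule.zero_mem _
      · rintro x hx v
        rw [(Submodule.mem_bot F).1 hx, zero_lie]
        exact Submodule.zero_mem _
      · rintro v hv w
        have hv' : br v = 0 := hv.2
        rw [hv', LinearMap.zero_apply]
        exact Submodule.zero_mem _
    obtain ⟨m0, m1, hm, h0, h1⟩ := hI.exists_isMinimalIdeal_le (Or.inr hne)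
    refine hm.2.1.elim (fun h => h (le_bot_iff.1 h0)) fun h => h ?_
    refine (Submodule.eq_bot_iff _).2 fun w hw => ?_
    exact LieSubmodule.eq_zero_of_disjoint hT.disjoint
      ⟨hm.le_COdd hw, (h1 hw).2⟩ (h1 hw).1
  obtain ⟨s, hs, t, ht, rfl⟩ := LieSubmodule.exists_add_of_isCompl hT v
  have hs' : br s = 0 := hs.2
  have ht' : br t = 0 := by rwa [map_add, hs', zero_add] at hv
  have ht0 : t ∈ (T ⊓ R).toSubmodule := ⟨ht, ht'⟩
  rw [hTR, Submodule.mem_bot] at ht0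
  rw [ht0, add_zero]
  exact hs.1

/-- An abelian ideal of a Lie algebra whose radical equals its center is central. -/
theorem lie_eq_zero_of_mem_abelian_ideal
    (hred : LieAlgebra.radical F g0 = LieAlgebra.center F g0) {l0 : Submodule F g0}
    (hl : ∀ a : g0, ∀ x ∈ l0, ⁅a, x⁆ ∈ l0) (hab : ∀ x ∈ l0, ∀ y ∈ l0, ⁅x, y⁆ = 0)
    {x : g0} (hx : x ∈ l0) (a : g0) : ⁅a, x⁆ = 0 := by
  let I : LieIdeal F g0 := { l0 with lie_mem := fun {a x} h => hl a x h }
  have hI : IsLieAbelian I := ⟨fun y z => Subtype.ext (hab y y.2 z z.2)⟩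
  have hle : I ≤ LieAlgebra.center F g0 :=
    hred ▸ (LieAlgebra.LieIdeal.solvable_iff_le_radical F g0 I).1 inferInstance
  exact (LieModule.mem_maxTrivSubmodule F g0 g0 x).1 (hle hx) a

/-- A central element acting with square zero on a semisimple module acts by zero. -/
theorem lie_eq_zero_of_central_of_lie_lie_eq_zero
    (hss : ∀ N : LieSubmodule F g0 g1, ∃ N', IsCompl N N') {x : g0}
    (hx : ∀ a : g0, ⁅a, x⁆ = 0) (hsq : ∀ v : g1, ⁅x, ⁅x, v⁆⁆ = 0) (v : g1) : ⁅x, v⁆ = 0 := by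
  let N : LieSubmodule F g0 g1 :=
    { LinearMap.ker (LieModule.toEnd F g0 g1 x) with
      lie_mem := fun {a v} h => by
        have hv : ⁅x, v⁆ = 0 := h
        change ⁅x, ⁅a, v⁆⁆ = 0
        rw [leibniz_lie, ← lie_skew, hx, neg_zero, zero_lie, hv, lie_zero, add_zero] }
  obtain ⟨N', hN⟩ := hss N
  obtain ⟨n, hn, n', hn', rfl⟩ := LieSubmodule.exists_add_of_isCompl hN v
  have hxn : ⁅x, n⁆ = 0 := hn
  rw [lie_add, hxn, zero_add]
  exact LieSubmodule.eq_zero_of_disjoint hN.disjoint (hsq n') (N'.lie_mem hn')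

theorem stmt8
    (br : g1 →ₗ[F] g1 →ₗ[F] g0)
    (hsymm : ∀ v w : g1, br v w = br w v)
    (hequiv : ∀ (a : g0) (v w : g1), ⁅a, br v w⁆ = br ⁅a, v⁆ w + br v ⁅a, w⁆)
    (hjac : ∀ u v w : g1, ⁅br u v, w⁆ + ⁅br v w, u⁆ + ⁅br w u, v⁆ = 0)
    (hred : LieAlgebra.radical F g0 = LieAlgebra.center F g0)
    (hss : ∀ N : LieSubmodule F g0 g1, ∃ N', IsCompl N N')
    (hZ0 : ∀ x : g0, (∀ a : g0, ⁅x, a⁆ = 0) → (∀ v : g1, ⁅x, v⁆ = 0) → x = 0)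
    (hZ1 : ∀ v : g1, (∀ a : g0, ⁅a, v⁆ = 0) → (∀ w : g1, br v w = 0) → v = 0) :
    (∀ x : g0, (∀ y ∈ CEven br, ⁅x, y⁆ = 0) → (∀ v ∈ COdd br, ⁅x, v⁆ = 0) → x = 0) ∧
    (∀ v : g1, (∀ a ∈ CEven br, ⁅a, v⁆ = 0) → (∀ w ∈ COdd br, br v w = 0) →
      v ∈ COdd br) := by
  set K0 := centralizerEven (CEven br) (COdd br)
  set K1 := centralizerOdd br (CEven br) (COdd br)
  have hK : IsIdeal br K0 K1 := (isIdeal_CEven_COdd br).centralizer hsymm hequiv hjac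
  have hK0 : K0 = ⊥ := by
    by_contra hne
    obtain ⟨M, hM⟩ := hss (oddRadical br hequiv)
    have hJ : IsIdeal br K0 (K1 ⊓ M.toSubmodule) := by
      refine ⟨hK.1, fun a v hv => ⟨hK.2.1 a v hv.1, M.lie_mem hv.2⟩, fun x hx v => ?_,
        fun v hv => hK.2.2.2 v hv.1⟩
      refine ⟨hK.2.2.1 x hx v, ?_⟩
      obtain ⟨r, hr, m, hm, rfl⟩ := LieSubmodule.exists_add_of_isCompl hM v
      rw [lie_add, hx.2 r (oddRadical_le_COdd hequiv hss hr), zero_add]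
      exact M.lie_mem hm
    obtain ⟨m0, m1, hm, h0, h1⟩ := hJ.exists_isMinimalIdeal_le (Or.inl hne)
    have hm0 : m0 = ⊥ := by
      refine (Submodule.eq_bot_iff _).2 fun x hx => ?_
      have hcen := lie_eq_zero_of_mem_abelian_ideal hred hm.1.1
        (fun x hx y hy => (h0 hx).1 y (hm.le_CEven hy)) hx
      refine hZ0 x (fun a => by rw [← lie_skew, hcen, neg_zero]) ?_
      exact lie_eq_zero_of_central_of_lie_lie_eq_zero hss hcen fun v =>
        (h0 hx).2 _ (hm.le_COdd (hm.1.2.2.1 x hx v))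
    refine hm.2.1.elim (fun h => h hm0) fun h => h ?_
    refine (Submodule.eq_bot_iff _).2 fun v hv => ?_
    refine LieSubmodule.eq_zero_of_disjoint hM.disjoint ?_ (h1 hv).2
    refine LinearMap.ext fun w => ?_
    have hvw := hm.1.2.2.2 v hv w
    rwa [hm0, Submodule.mem_bot] at hvw
  refine ⟨fun x hx0 hx1 => ?_, fun v hv0 hv1 => ?_⟩
  · have hx : x ∈ K0 := ⟨hx0, hx1⟩
    rwa [hK0, Submodule.mem_bot] at hx
  · refine oddRadical_le_COdd hequiv hss (LinearMap.ext fun w => ?_)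
    have hvw : br v w ∈ K0 := hK.2.2.2 v ⟨hv0, hv1⟩ w
    rwa [hK0, Submodule.mem_bot] at hvw
end
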